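/- (Main Theorem 2: modular parametrizations of the exceptional singularities Q₁₈: x³+y⁸+yz² = 0, E₂₀: x³+y¹¹+z² = 0, and x⁷+x²y³+z² = 0.) For every z in the upper half-plane ℍ, writing Φ_j = Φ_j(x(z)) where x(z) = (x₁(z),...,x₆(z)) is the vector of eta-multiplied theta constants of order 13, the following seven identities hold: Φ₂₀³·Φ₁₂² − Φ₄₂² = 1728·Φ₁₂⁷; Φ₃₂³ − Φ₁₂⁵·Φ₁₈² = 1728·Φ₁₂⁸; Φ₃₂³ − Φ₁₂³·Φ₃₀² = 1728·Φ₁₂⁸; Φ₃₂³ − Φ₁₂·Φ₄₂² = 1728·Φ₁₂⁸; Φ₄₄³ − Φ₁₂⁸·Φ₁₈² = 1728·Φ₁₂¹¹; Φ₄₄³ − Φ₁₂⁶·Φ₃₀² = 1728·Φ₁₂¹¹; Φ₄₄³ − Φ₁₂⁴·Φ₄₂² = 1728·Φ₁₂¹¹. -/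

import Mathlib

noncomputable section

open Complex

def ζ : ℂ := Complex.exp (2 * Real.pi * Complex.I / 13)

def AA0 (v : Fin 6 → ℂ) : ℂ := v 0 * v 3 + v 1 * v 4 + v 2 * v 5
def AA1 (v : Fin 6 → ℂ) : ℂ := (v 0) ^ 2 - 2 * v 2 * v 3
def AA2 (v : Fin 6 → ℂ) : ℂ := -(v 4) ^ 2 - 2 * v 1 * v 3
def AA3 (v : Fin 6 → ℂ) : ℂ := (v 1) ^ 2 - 2 * v 0 * v 4
def AA4 (v : Fin 6 → ℂ) : ℂ := (v 2) ^ 2 - 2 * v 1 * v 5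
def AA5 (v : Fin 6 → ℂ) : ℂ := -(v 3) ^ 2 - 2 * v 0 * v 5
def AA6 (v : Fin 6 → ℂ) : ℂ := -(v 5) ^ 2 - 2 * v 2 * v 4

def DD0 (v : Fin 6 → ℂ) : ℂ := v 0 * v 1 * v 2
def DD1 (v : Fin 6 → ℂ) : ℂ := 2 * v 1 * (v 2) ^ 2 + (v 1) ^ 2 * v 5 - (v 3) ^ 2 * v 4 + v 0 * v 4 * v 5
def DD2 (v : Fin 6 → ℂ) : ℂ := -(v 5) ^ 3 + (v 1) ^ 2 * v 3 - 2 * v 1 * (v 4) ^ 2 + v 0 * v 3 * v 4 + 3 * v 2 * v 4 * v 5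
def DD3 (v : Fin 6 → ℂ) : ℂ := 2 * v 0 * (v 1) ^ 2 + (v 0) ^ 2 * v 4 - v 3 * (v 5) ^ 2 + v 2 * v 3 * v 4
def DD4 (v : Fin 6 → ℂ) : ℂ := -(v 1) ^ 2 * v 2 + v 0 * (v 5) ^ 2 - 2 * (v 3) ^ 2 * v 5 - v 0 * v 2 * v 4
def DD5 (v : Fin 6 → ℂ) : ℂ := -(v 3) ^ 3 + (v 2) ^ 2 * v 4 - 2 * v 2 * (v 5) ^ 2 + v 1 * v 4 * v 5 + 3 * v 0 * v 3 * v 5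
def DD6 (v : Fin 6 → ℂ) : ℂ := -(v 4) ^ 3 + (v 0) ^ 2 * v 5 - 2 * v 0 * (v 3) ^ 2 + v 2 * v 3 * v 5 + 3 * v 1 * v 3 * v 4
def DD7 (v : Fin 6 → ℂ) : ℂ := -(v 1) ^ 3 + v 2 * (v 3) ^ 2 - v 0 * v 2 * v 5 - 3 * v 0 * v 1 * v 4 + 2 * (v 0) ^ 2 * v 3
def DD8 (v : Fin 6 → ℂ) : ℂ := -(v 0) ^ 3 + v 1 * (v 5) ^ 2 - v 1 * v 2 * v 4 - 3 * v 0 * v 2 * v 3 + 2 * (v 2) ^ 2 * v 5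
def DD9 (v : Fin 6 → ℂ) : ℂ := 2 * (v 0) ^ 2 * v 2 + (v 2) ^ 2 * v 3 - (v 4) ^ 2 * v 5 + v 1 * v 3 * v 5
def DD10 (v : Fin 6 → ℂ) : ℂ := -(v 0) * (v 2) ^ 2 + v 1 * (v 3) ^ 2 - 2 * v 3 * (v 4) ^ 2 - v 0 * v 1 * v 5
def DD11 (v : Fin 6 → ℂ) : ℂ := -(v 2) ^ 3 + v 0 * (v 4) ^ 2 - v 0 * v 1 * v 3 - 3 * v 1 * v 2 * v 5 + 2 * (v 1) ^ 2 * v 4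
def DD12 (v : Fin 6 → ℂ) : ℂ := -(v 0) ^ 2 * v 1 + v 2 * (v 4) ^ 2 - 2 * v 4 * (v 5) ^ 2 - v 1 * v 2 * v 3
def DDinf (v : Fin 6 → ℂ) : ℂ := v 3 * v 4 * v 5

def GG0 (v : Fin 6 → ℂ) : ℂ := (DD0 v) ^ 2 + (DDinf v) ^ 2
def GG1 (v : Fin 6 → ℂ) : ℂ := -(DD7 v) ^ 2 + 2 * DD0 v * DD1 v + 10 * DDinf v * DD1 v + 2 * DD2 v * DD12 v - 2 * DD3 v * DD11 v - 4 * DD4 v * DD10 v - 2 * DD9 v * DD5 v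
def GG2 (v : Fin 6 → ℂ) : ℂ := -2 * (DD1 v) ^ 2 - 4 * DD0 v * DD2 v + 6 * DDinf v * DD2 v - 2 * DD4 v * DD11 v + 2 * DD5 v * DD10 v - 2 * DD6 v * DD9 v - 2 * DD7 v * DD8 v
def GG3 (v : Fin 6 → ℂ) : ℂ := -(DD8 v) ^ 2 + 2 * DD0 v * DD3 v + 10 * DDinf v * DD3 v + 2 * DD6 v * DD10 v - 2 * DD9 v * DD7 v - 4 * DD12 v * DD4 v - 2 * DD1 v * DD2 v
def GG4 (v : Fin 6 → ℂ) : ℂ := -(DD2 v) ^ 2 + 10 * DD0 v * DD4 v - 2 * DDinf v * DD4 v + 2 * DD5 v * DD12 v - 2 * DD9 v * DD8 v - 4 * DD1 v * DD3 v - 2 * DD10 v * DD7 v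
def GG5 (v : Fin 6 → ℂ) : ℂ := -2 * (DD9 v) ^ 2 - 4 * DD0 v * DD5 v + 6 * DDinf v * DD5 v - 2 * DD10 v * DD8 v + 2 * DD6 v * DD12 v - 2 * DD2 v * DD3 v - 2 * DD11 v * DD7 v
def GG6 (v : Fin 6 → ℂ) : ℂ := -2 * (DD3 v) ^ 2 - 4 * DD0 v * DD6 v + 6 * DDinf v * DD6 v - 2 * DD12 v * DD7 v + 2 * DD2 v * DD4 v - 2 * DD5 v * DD1 v - 2 * DD8 v * DD11 v
def GG7 (v : Fin 6 → ℂ) : ℂ := -2 * (DD10 v) ^ 2 + 6 * DD0 v * DD7 v + 4 * DDinf v * DD7 v - 2 * DD1 v * DD6 v - 2 * DD2 v * DD5 v - 2 * DD8 v * DD12 v - 2 * DD9 v * DD11 v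
def GG8 (v : Fin 6 → ℂ) : ℂ := -2 * (DD4 v) ^ 2 + 6 * DD0 v * DD8 v + 4 * DDinf v * DD8 v - 2 * DD3 v * DD5 v - 2 * DD6 v * DD2 v - 2 * DD11 v * DD10 v - 2 * DD1 v * DD7 v
def GG9 (v : Fin 6 → ℂ) : ℂ := -(DD11 v) ^ 2 + 2 * DD0 v * DD9 v + 10 * DDinf v * DD9 v + 2 * DD5 v * DD4 v - 2 * DD1 v * DD8 v - 4 * DD10 v * DD12 v - 2 * DD3 v * DD6 v
def GG10 (v : Fin 6 → ℂ) : ℂ := -(DD5 v) ^ 2 + 10 * DD0 v * DD10 v - 2 * DDinf v * DD10 v + 2 * DD6 v * DD4 v - 2 * DD3 v * DD7 v - 4 * DD9 v * DD1 v - 2 * DD12 v * DD11 v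
def GG11 (v : Fin 6 → ℂ) : ℂ := -2 * (DD12 v) ^ 2 + 6 * DD0 v * DD11 v + 4 * DDinf v * DD11 v - 2 * DD9 v * DD2 v - 2 * DD5 v * DD6 v - 2 * DD7 v * DD4 v - 2 * DD3 v * DD8 v
def GG12 (v : Fin 6 → ℂ) : ℂ := -(DD6 v) ^ 2 + 10 * DD0 v * DD12 v - 2 * DDinf v * DD12 v + 2 * DD2 v * DD10 v - 2 * DD1 v * DD11 v - 4 * DD3 v * DD9 v - 2 * DD4 v * DD8 v

def wInf (v : Fin 6 → ℂ) : ℂ := 13 * (AA0 v) ^ 2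
def wF (ν : ℕ) (v : Fin 6 → ℂ) : ℂ :=
  (AA0 v + ζ ^ ν * AA1 v + ζ ^ (4 * ν) * AA2 v + ζ ^ (9 * ν) * AA3 v + ζ ^ (3 * ν) * AA4 v
    + ζ ^ (12 * ν) * AA5 v + ζ ^ (10 * ν) * AA6 v) ^ 2
def dInf (v : Fin 6 → ℂ) : ℂ := 13 ^ 2 * GG0 v
def dF (ν : ℕ) (v : Fin 6 → ℂ) : ℂ :=
  -13 * GG0 v + ζ ^ ν * GG1 v + ζ ^ (2 * ν) * GG2 v + ζ ^ (3 * ν) * GG3 v + ζ ^ (4 * ν) * GG4 v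
    + ζ ^ (5 * ν) * GG5 v + ζ ^ (6 * ν) * GG6 v + ζ ^ (7 * ν) * GG7 v + ζ ^ (8 * ν) * GG8 v
    + ζ ^ (9 * ν) * GG9 v + ζ ^ (10 * ν) * GG10 v + ζ ^ (11 * ν) * GG11 v + ζ ^ (12 * ν) * GG12 v

def Phi12 (v : Fin 6 → ℂ) : ℂ :=
  -(1 / (13 * 52) : ℂ) * ((∑ ν ∈ Finset.range 13, (dF ν v) ^ 2) + (dInf v) ^ 2)
def Phi18 (v : Fin 6 → ℂ) : ℂ :=
  (1 / (13 * 6) : ℂ) * ((∑ ν ∈ Finset.range 13, (dF ν v) ^ 3) + (dInf v) ^ 3)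
def Phi30 (v : Fin 6 → ℂ) : ℂ :=
  -(1 / (13 * 1315) : ℂ) * ((∑ ν ∈ Finset.range 13, (dF ν v) ^ 5) + (dInf v) ^ 5)
def Phi42 (v : Fin 6 → ℂ) : ℂ :=
  (1 / (13 * 226842) : ℂ) * ((∑ ν ∈ Finset.range 13, (dF ν v) ^ 7) + (dInf v) ^ 7)

def Phi20 (v : Fin 6 → ℂ) : ℂ :=
  (1 / (13 * 25) : ℂ) * ((∑ ν ∈ Finset.range 13, (wF ν v) ^ 5) + (wInf v) ^ 5)
def Phi32 (v : Fin 6 → ℂ) : ℂ :=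
  -(1 / (13 * 1840) : ℂ) * ((∑ ν ∈ Finset.range 13, (wF ν v) ^ 8) + (wInf v) ^ 8)
def Phi44 (v : Fin 6 → ℂ) : ℂ :=
  (1 / (13 * 146905) : ℂ) * ((∑ ν ∈ Finset.range 13, (wF ν v) ^ 11) + (wInf v) ^ 11)

def th13 (c : ℚ) (k : ℤ) (z : ℂ) : ℂ :=
  Complex.exp (2 * Real.pi * Complex.I * (c : ℂ) * z) *
    ∑' n : ℤ, (-1 : ℂ) ^ n *
      Complex.exp (2 * Real.pi * Complex.I * (((13 * n ^ 2 + k * n : ℤ) : ℂ) / 2) * z)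

def ta : Fin 6 → ℂ → ℂ :=
  ![th13 (121 / 104) 11, th13 (49 / 104) 7, th13 (25 / 104) 5,
    fun z => -th13 (9 / 104) 3 z, th13 (81 / 104) 9, th13 (1 / 104) 1]

def AV (z : ℂ) : Fin 6 → ℂ := fun i => ta i z

def etaF (z : ℂ) : ℂ :=
  Complex.exp (2 * Real.pi * Complex.I * z / 24) *
    ∏' n : ℕ, (1 - Complex.exp (2 * Real.pi * Complex.I * z) ^ (n + 1))

def xV (z : ℂ) : Fin 6 → ℂ := fun i => etaF z * ta i z

def Δfun (z : ℂ) : ℂ := (etaF z) ^ 24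

def Eis (k : ℕ) (z : ℂ) : ℂ :=
  (1 / 2 : ℂ) * ∑' p : {p : ℤ × ℤ // Int.gcd p.1 p.2 = 1},
    1 / ((p.val.1 : ℂ) * z + (p.val.2 : ℂ)) ^ k

/-! ### The Weil representation on odd functions on `ZMod 13` -/

/-- The standard additive character of `ZMod 13`. -/
abbrev ψ : AddChar (ZMod 13) ℂ := ZMod.stdAddChar

/-- The (unnormalised) finite Fourier transform of the Weil representation. -/
def weilS (f : ZMod 13 → ℂ) (k : ZMod 13) : ℂ := ∑ l, ψ (10 * k * l) * f l

/-- Multiplication by a quadratic character of second kind. -/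
def weilT (a : ZMod 13) (f : ZMod 13 → ℂ) (k : ZMod 13) : ℂ := ψ (5 * a * k ^ 2) * f k

/-- Dilation of the argument. -/
def dil (a : ZMod 13) (f : ZMod 13 → ℂ) (k : ZMod 13) : ℂ := f (a * k)

instance fact_prime_thirteen : Fact (Nat.Prime 13) := ⟨by norm_num⟩

lemma sum_psi_mul (b : ZMod 13) : ∑ x, ψ (x * b) = if b = 0 then 13 else 0 := by
  have := AddChar.sum_mulShift (R := ZMod 13) (R' := ℂ) (ψ := ZMod.stdAddChar) b
    (ZMod.isPrimitive_stdAddChar 13)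
  rw [this]
  split_ifs <;> simp [ZMod.card]

lemma Function.Odd.weilT {f : ZMod 13 → ℂ} (hf : f.Odd) (a : ZMod 13) : (weilT a f).Odd := by
  intro k
  simp [_root_.weilT, hf k]

lemma Function.Odd.dil {f : ZMod 13 → ℂ} (hf : f.Odd) (a : ZMod 13) : (dil a f).Odd := by
  intro k
  simp [_root_.dil, hf (a * k)]

lemma Function.Odd.weilS {f : ZMod 13 → ℂ} (hf : f.Odd) : (weilS f).Odd := by
  intro k
  simp only [_root_.weilS, ← Finset.sum_neg_distrib]
  refine Fintype.sum_equiv (Equiv.neg _) _ _ fun l => ?_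
  simp [hf l]

lemma weilT_weilT (a b : ZMod 13) (f : ZMod 13 → ℂ) : weilT a (weilT b f) = weilT (a + b) f := by
  funext k
  simp only [weilT, ← mul_assoc, ← AddChar.map_add_eq_mul]
  ring_nf

lemma weilT_zero (f : ZMod 13 → ℂ) : weilT 0 f = f := by
  funext k
  simp [weilT]

lemma weilT_smul (a : ZMod 13) (c : ℂ) (f : ZMod 13 → ℂ) : weilT a (c • f) = c • weilT a f := by
  funext k
  simp only [weilT, Pi.smul_apply, smul_eq_mul]
  ring

lemma weilS_smul (c : ℂ) (f : ZMod 13 → ℂ) : weilS (c • f) = c • weilS f := by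
  funext k
  simp only [weilS, Pi.smul_apply, smul_eq_mul, Finset.mul_sum]
  exact Finset.sum_congr rfl fun l _ => by ring

lemma weilS_weilS {f : ZMod 13 → ℂ} (hf : f.Odd) : weilS (weilS f) = (-13 : ℂ) • f := by
  funext k
  have h (m : ZMod 13) :
      ∑ l, ψ (10 * k * l) * (ψ (10 * l * m) * f m) = if m = -k then 13 * f m else 0 := by
    have h1 (l : ZMod 13) : ψ (10 * k * l) * (ψ (10 * l * m) * f m)
        = ψ (l * (10 * (k + m))) * f m := by
      rw [← mul_assoc, ← AddChar.map_add_eq_mul]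
      ring_nf
    have h2 : 10 * (k + m) = 0 ↔ m = -k := by
      rw [mul_eq_zero, or_iff_right (by decide), add_comm, add_eq_zero_iff_eq_neg]
    simp only [h1, ← Finset.sum_mul, sum_psi_mul, h2]
    split_ifs <;> simp
  calc weilS (weilS f) k = ∑ l, ∑ m, ψ (10 * k * l) * (ψ (10 * l * m) * f m) := by
        simp only [weilS, Finset.mul_sum]
    _ = ∑ m, ∑ l, ψ (10 * k * l) * (ψ (10 * l * m) * f m) := Finset.sum_comm
    _ = _ := by
        simp only [h, Finset.sum_ite_eq', Finset.mem_univ, if_true, Pi.smul_apply, smul_eq_mul,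
          hf k]
        ring

/-- The quadratic Gauss sum attached to `ν`. -/
def gaussG (ν : ZMod 13) : ℂ := ∑ l, ψ (5 * ν * l ^ 2)

lemma gaussG_sq {ν : ZMod 13} (hν : ν ≠ 0) : gaussG ν ^ 2 = 13 := by
  have h13 : (13 : ZMod 13) = 0 := by decide
  let e : (ZMod 13 × ZMod 13) ≃ (ZMod 13 × ZMod 13) :=
    { toFun := fun p => (p.1 + 5 * p.2, p.1 - 5 * p.2)
      invFun := fun p => (7 * (p.1 + p.2), 4 * (p.1 - p.2))
      left_inv := fun p => Prod.ext (by linear_combination p.1 * h13)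
        (by linear_combination 3 * p.2 * h13)
      right_inv := fun p => Prod.ext (by linear_combination (2 * p.1 - p.2) * h13)
        (by linear_combination (2 * p.2 - p.1) * h13) }
  have h1 : gaussG ν ^ 2 = ∑ p : ZMod 13 × ZMod 13, ψ (p.1 * (5 * ν * p.2)) := by
    rw [sq, gaussG, Finset.sum_mul_sum, ← Finset.sum_product', Finset.univ_product_univ]
    refine Fintype.sum_equiv e _ _ fun p => ?_
    rw [← AddChar.map_add_eq_mul]
    congr 1
    simp only [e, Equiv.coe_fn_mk]
    linear_combination 10 * ν * p.2 ^ 2 * h13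
  have h2 (x : ZMod 13) : 5 * ν * x = 0 ↔ x = 0 := by
    rw [mul_eq_zero, or_iff_right (mul_ne_zero (by decide) hν)]
  rw [h1, ← Finset.univ_product_univ, Finset.sum_product_right]
  simp [sum_psi_mul, h2]

lemma weilS_weilT_weilS {ν : ZMod 13} (hν : ν ≠ 0) (f : ZMod 13 → ℂ) :
    weilS (weilT ν (weilS f))
      = gaussG ν • weilT (-ν⁻¹) (dil (-ν⁻¹) (weilS (weilT (-ν⁻¹) f))) := by
  funext k
  have h (m : ZMod 13) :
      ∑ l, ψ (10 * k * l) * (ψ (5 * ν * l ^ 2) * (ψ (10 * l * m) * f m))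
        = gaussG ν * (ψ (-5 * ν⁻¹ * (k + m) ^ 2) * f m) := by
    rw [gaussG, Finset.sum_mul]
    refine Fintype.sum_equiv (Equiv.addRight (ν⁻¹ * (k + m))) _ _ fun l => ?_
    simp only [← mul_assoc, ← AddChar.map_add_eq_mul, Equiv.coe_addRight]
    congr 2
    field_simp
    ring
  calc weilS (weilT ν (weilS f)) k
      = ∑ l, ∑ m, ψ (10 * k * l) * (ψ (5 * ν * l ^ 2) * (ψ (10 * l * m) * f m)) := by
        simp only [weilS, weilT, Finset.mul_sum]
    _ = ∑ m, ∑ l, ψ (10 * k * l) * (ψ (5 * ν * l ^ 2) * (ψ (10 * l * m) * f m)) :=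
        Finset.sum_comm
    _ = _ := by
        simp only [h, Pi.smul_apply, smul_eq_mul, weilT, dil, weilS, Finset.mul_sum]
        refine Finset.sum_congr rfl fun m _ => ?_
        have h1 : ψ (-5 * ν⁻¹ * (k + m) ^ 2)
            = ψ (5 * -ν⁻¹ * k ^ 2) * (ψ (10 * (-ν⁻¹ * k) * m) * ψ (5 * -ν⁻¹ * m ^ 2)) := by
          rw [← AddChar.map_add_eq_mul, ← AddChar.map_add_eq_mul]
          congr 1
          ring
        rw [h1]
        ring

/-- Power sums of the fourteen conjugates of `F`. -/
def powSum (F : (ZMod 13 → ℂ) → ℂ) (e k : ℕ) (f : ZMod 13 → ℂ) : ℂ :=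
  ∑ ν, F (weilS (weilT ν f)) ^ k + (13 ^ e * F f) ^ k

lemma powSum_smul {F : (ZMod 13 → ℂ) → ℂ} {e : ℕ}
    (hsmul : ∀ (c : ℂ) f, F (c • f) = c ^ (2 * e) * F f) (k : ℕ) (c : ℂ) (f : ZMod 13 → ℂ) :
    powSum F e k (c • f) = c ^ (2 * e * k) * powSum F e k f := by
  simp only [powSum, weilT_smul, weilS_smul, hsmul, mul_pow, mul_add, Finset.mul_sum, pow_mul]
  ring

lemma powSum_weilT {F : (ZMod 13 → ℂ) → ℂ} (e : ℕ) 
    (hT : ∀ a f, Function.Odd f → F (weilT a f) = F f) (k : ℕ) (a : ZMod 13)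
    {f : ZMod 13 → ℂ} (hf : f.Odd) :
    powSum F e k (weilT a f) = powSum F e k f := by
  simp only [powSum, weilT_weilT, hT a f hf]
  congr 1
  exact Fintype.sum_equiv (Equiv.addRight a) _ _ fun ν => rfl

lemma powSum_weilS {F : (ZMod 13 → ℂ) → ℂ} {e : ℕ}
    (hsmul : ∀ (c : ℂ) f, F (c • f) = c ^ (2 * e) * F f)
    (hT : ∀ a f, Function.Odd f → F (weilT a f) = F f)
    (hdil : ∀ a f, a ≠ 0 → Function.Odd f → F (dil a f) = F f) (k : ℕ)
    {f : ZMod 13 → ℂ} (hf : f.Odd) :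
    powSum F e k (weilS f) = 13 ^ (e * k) * powSum F e k f := by
  have key (ν : ZMod 13) (hν : ν ≠ 0) :
      F (weilS (weilT ν (weilS f))) = 13 ^ e * F (weilS (weilT (-ν⁻¹) f)) := by
    have hS := (hf.weilT (-ν⁻¹)).weilS
    rw [weilS_weilT_weilS hν, hsmul, hT _ _ (hS.dil _), hdil _ _ (by simpa using hν) hS, pow_mul,
      gaussG_sq hν]
  have h0 : F (weilS (weilS f)) = 13 ^ e * (13 ^ e * F f) := by
    rw [weilS_weilS hf, hsmul, pow_mul, ← mul_assoc, ← mul_pow]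
    norm_num
  have hsum : ∑ ν ∈ ({0}ᶜ : Finset (ZMod 13)), F (weilS (weilT ν (weilS f))) ^ k
      = ∑ ν ∈ ({0}ᶜ : Finset (ZMod 13)), (13 ^ e * F (weilS (weilT ν f))) ^ k := by
    refine Finset.sum_nbij' (fun ν => -ν⁻¹) (fun ν => -ν⁻¹) ?_ ?_ ?_ ?_ ?_
    · intro ν hν; simpa using hν
    · intro ν hν; simpa using hν
    · intro ν _; simp
    · intro ν _; simp
    · intro ν hν
      rw [key ν (by simpa using hν)]
  unfold powSum
  rw [Fintype.sum_eq_add_sum_compl (0 : ZMod 13), Fintype.sum_eq_add_sum_compl (0 : ZMod 13), hsum,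
    weilT_zero, weilT_zero, h0]
  simp only [mul_pow, ← Finset.mul_sum, ← pow_mul]
  ring

/-- Odd part of the standard character. -/
def cc (n : ZMod 13) : ℂ := ψ n - ψ (-n)

/-- Even part of the standard character. -/
def dd (n : ZMod 13) : ℂ := ψ n + ψ (-n)

lemma cc_neg (n : ZMod 13) : cc (-n) = -cc n := by
  simp [cc]

lemma dd_neg (n : ZMod 13) : dd (-n) = dd n := by
  simp [dd, add_comm]

lemma cc_zero : cc 0 = 0 := by
  simp [cc]

lemma dd_zero : dd 0 = 2 := by
  norm_num [dd]

lemma cc_mul_cc (a b : ZMod 13) : cc a * cc b = dd (a + b) - dd (a - b) := by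
  simp only [cc, dd, mul_sub, sub_mul, ← AddChar.map_add_eq_mul]
  ring_nf

lemma cc_mul_cc_mul_cc (a b c : ZMod 13) :
    cc a * cc b * cc c = cc (a + b + c) - cc (a + b - c) - cc (a - b + c) + cc (a - b - c) := by
  simp only [cc, mul_sub, sub_mul, ← AddChar.map_add_eq_mul]
  ring_nf

lemma cc_reduce :
    cc 7 = -cc 6 ∧ cc 8 = -cc 5 ∧ cc 9 = -cc 4 ∧ cc 10 = -cc 3 ∧ cc 11 = -cc 2 ∧ cc 12 = -cc 1 ∧
    cc 14 = cc 1 ∧ cc 15 = cc 2 ∧ cc 16 = cc 3 ∧ cc 17 = cc 4 ∧ cc 18 = cc 5 := by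
  simp only [← cc_neg]
  refine ⟨?_, ?_, ?_, ?_, ?_, ?_, ?_, ?_, ?_, ?_, ?_⟩ <;> congr 1

lemma cc_thirteen : cc 13 = 0 := by
  rw [← cc_zero]
  congr 1

lemma dd_reduce :
    dd 7 = dd 6 ∧ dd 8 = dd 5 ∧ dd 9 = dd 4 ∧ dd 10 = dd 3 ∧ dd 11 = dd 2 ∧ dd 12 = dd 1 := by
  refine ⟨?_, ?_, ?_, ?_, ?_, ?_⟩ <;> rw [← dd_neg] <;> congr 1

lemma sum_eq_cc_sum {g : ZMod 13 → ℂ} :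
    ∑ l, g l = g 0 + (g 1 + g (-1)) + (g 2 + g (-2)) + (g 3 + g (-3)) + (g 4 + g (-4))
      + (g 5 + g (-5)) + (g 6 + g (-6)) := by
  rw [show (Finset.univ : Finset (ZMod 13)) = {0, 1, -1, 2, -2, 3, -3, 4, -4, 5, -5, 6, -6} by
    decide]
  repeat rw [Finset.sum_insert (by decide)]
  rw [Finset.sum_singleton]
  ring

lemma one_add_sum_dd : 1 + dd 1 + dd 2 + dd 3 + dd 4 + dd 5 + dd 6 = 0 := by
  have h := sum_psi_mul 1
  simp only [mul_one, sum_eq_cc_sum, AddChar.map_zero_eq_one] at h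
  rw [if_neg (by decide)] at h
  simp only [dd]
  linear_combination h

lemma weilS_eq_sum_cc {f : ZMod 13 → ℂ} (hf : f.Odd) (k : ZMod 13) :
    weilS f k = cc (10 * k * 1) * f 1 + cc (10 * k * 2) * f 2 + cc (10 * k * 3) * f 3
      + cc (10 * k * 4) * f 4 + cc (10 * k * 5) * f 5 + cc (10 * k * 6) * f 6 := by
  have h0 : f 0 = 0 := by
    have := hf 0
    rw [neg_zero] at this
    linear_combination this / 2
  simp only [weilS, sum_eq_cc_sum, hf _, h0, cc, mul_neg]
  ring

lemma weilS_apply_two {f : ZMod 13 → ℂ} (hf : f.Odd) : weilS f 2 =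
    -cc 6 * f 1 + cc 1 * f 2 - cc 5 * f 3 + cc 2 * f 4 - cc 4 * f 5 + cc 3 * f 6 := by
  rw [weilS_eq_sum_cc hf]
  simp only [show (10 * 2 * 1 : ZMod 13) = -6 by decide, show (10 * 2 * 2 : ZMod 13) = 1 by
  decide, show (10 * 2 * 3 : ZMod 13) = -5 by decide, show (10 * 2 * 4 : ZMod 13) = 2 by decide,
  show (10 * 2 * 5 : ZMod 13) = -4 by decide, show (10 * 2 * 6 : ZMod 13) = 3 by decide, cc_neg]
  ring

lemma weilS_apply_six {f : ZMod 13 → ℂ} (hf : f.Odd) : weilS f 6 =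
    -cc 5 * f 1 + cc 3 * f 2 - cc 2 * f 3 + cc 6 * f 4 + cc 1 * f 5 - cc 4 * f 6 := by
  rw [weilS_eq_sum_cc hf]
  simp only [show (10 * 6 * 1 : ZMod 13) = -5 by decide, show (10 * 6 * 2 : ZMod 13) = 3 by
  decide, show (10 * 6 * 3 : ZMod 13) = -2 by decide, show (10 * 6 * 4 : ZMod 13) = 6 by decide,
  show (10 * 6 * 5 : ZMod 13) = 1 by decide, show (10 * 6 * 6 : ZMod 13) = -4 by decide, cc_neg]
  ring

lemma weilS_apply_five {f : ZMod 13 → ℂ} (hf : f.Odd) : weilS f 5 =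
    -cc 2 * f 1 - cc 4 * f 2 - cc 6 * f 3 + cc 5 * f 4 + cc 3 * f 5 + cc 1 * f 6 := by
  rw [weilS_eq_sum_cc hf]
  simp only [show (10 * 5 * 1 : ZMod 13) = -2 by decide, show (10 * 5 * 2 : ZMod 13) = -4 by
  decide, show (10 * 5 * 3 : ZMod 13) = -6 by decide, show (10 * 5 * 4 : ZMod 13) = 5 by decide,
  show (10 * 5 * 5 : ZMod 13) = 3 by decide, show (10 * 5 * 6 : ZMod 13) = 1 by decide, cc_neg]
  ring

lemma weilS_apply_three {f : ZMod 13 → ℂ} (hf : f.Odd) : weilS f 3 =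
    cc 4 * f 1 - cc 5 * f 2 - cc 1 * f 3 + cc 3 * f 4 - cc 6 * f 5 - cc 2 * f 6 := by
  rw [weilS_eq_sum_cc hf]
  simp only [show (10 * 3 * 1 : ZMod 13) = 4 by decide, show (10 * 3 * 2 : ZMod 13) = -5 by
  decide, show (10 * 3 * 3 : ZMod 13) = -1 by decide, show (10 * 3 * 4 : ZMod 13) = 3 by decide,
  show (10 * 3 * 5 : ZMod 13) = -6 by decide, show (10 * 3 * 6 : ZMod 13) = -2 by decide, cc_neg]
  ring

lemma weilS_apply_nine {f : ZMod 13 → ℂ} (hf : f.Odd) : weilS f 9 =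
    -cc 1 * f 1 - cc 2 * f 2 - cc 3 * f 3 - cc 4 * f 4 - cc 5 * f 5 - cc 6 * f 6 := by
  rw [weilS_eq_sum_cc hf]
  simp only [show (10 * 9 * 1 : ZMod 13) = -1 by decide, show (10 * 9 * 2 : ZMod 13) = -2 by
  decide, show (10 * 9 * 3 : ZMod 13) = -3 by decide, show (10 * 9 * 4 : ZMod 13) = -4 by decide,
  show (10 * 9 * 5 : ZMod 13) = -5 by decide, show (10 * 9 * 6 : ZMod 13) = -6 by decide, cc_neg]
  ring

lemma weilS_apply_one {f : ZMod 13 → ℂ} (hf : f.Odd) : weilS f 1 =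
    -cc 3 * f 1 - cc 6 * f 2 + cc 4 * f 3 + cc 1 * f 4 - cc 2 * f 5 - cc 5 * f 6 := by
  rw [weilS_eq_sum_cc hf]
  simp only [show (10 * 1 * 1 : ZMod 13) = -3 by decide, show (10 * 1 * 2 : ZMod 13) = -6 by
  decide, show (10 * 1 * 3 : ZMod 13) = 4 by decide, show (10 * 1 * 4 : ZMod 13) = 1 by decide,
  show (10 * 1 * 5 : ZMod 13) = -2 by decide, show (10 * 1 * 6 : ZMod 13) = -5 by decide, cc_neg]
  ring

/-- The coordinate vector of an odd function on `ZMod 13`. -/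
def toVec (f : ZMod 13 → ℂ) : Fin 6 → ℂ := ![f 2, f 6, f 5, f 3, f 9, f 1]

lemma Function.Odd.apply_nine {f : ZMod 13 → ℂ} (hf : f.Odd) : f 9 = -f 4 := by
  rw [← hf 4]
  congr 1

lemma AA0_weilS {f : ZMod 13 → ℂ} (hf : f.Odd) :
    AA0 (toVec (weilS f)) = (dd 1 + dd 3 + dd 4 - dd 2 - dd 5 - dd 6) *
      (AA0 (toVec f) + AA1 (toVec f) + AA2 (toVec f) + AA3 (toVec f) + AA4 (toVec f)
        + AA5 (toVec f) + AA6 (toVec f)) := by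
  have hsum := one_add_sum_dd
  have h11 : cc 1 * cc 1 = dd 2 - 2 := by
    rw [cc_mul_cc]; norm_num [dd_reduce, dd_neg, dd_zero]
  have h12 : cc 1 * cc 2 = -dd 1 + dd 3 := by
    rw [cc_mul_cc]; norm_num [dd_reduce, dd_neg, dd_zero]; ring
  have h13 : cc 1 * cc 3 = -dd 2 + dd 4 := by
    rw [cc_mul_cc]; norm_num [dd_reduce, dd_neg, dd_zero]; ring
  have h14 : cc 1 * cc 4 = -dd 3 + dd 5 := by
    rw [cc_mul_cc]; norm_num [dd_reduce, dd_neg, dd_zero]; ring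
  have h15 : cc 1 * cc 5 = -dd 4 + dd 6 := by
    rw [cc_mul_cc]; norm_num [dd_reduce, dd_neg, dd_zero]; ring
  have h16 : cc 1 * cc 6 = -dd 5 + dd 6 := by
    rw [cc_mul_cc]; norm_num [dd_reduce, dd_neg, dd_zero]; ring
  have h22 : cc 2 * cc 2 = dd 4 - 2 := by
    rw [cc_mul_cc]; norm_num [dd_reduce, dd_neg, dd_zero]
  have h23 : cc 2 * cc 3 = -dd 1 + dd 5 := by
    rw [cc_mul_cc]; norm_num [dd_reduce, dd_neg, dd_zero]; ring
  have h24 : cc 2 * cc 4 = -dd 2 + dd 6 := by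
    rw [cc_mul_cc]; norm_num [dd_reduce, dd_neg, dd_zero]; ring
  have h25 : cc 2 * cc 5 = -dd 3 + dd 6 := by
    rw [cc_mul_cc]; norm_num [dd_reduce, dd_neg, dd_zero]; ring
  have h26 : cc 2 * cc 6 = -dd 4 + dd 5 := by
    rw [cc_mul_cc]; norm_num [dd_reduce, dd_neg, dd_zero]; ring
  have h33 : cc 3 * cc 3 = dd 6 - 2 := by
    rw [cc_mul_cc]; norm_num [dd_reduce, dd_neg, dd_zero]
  have h34 : cc 3 * cc 4 = -dd 1 + dd 6 := by
    rw [cc_mul_cc]; norm_num [dd_reduce, dd_neg, dd_zero]; ring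
  have h35 : cc 3 * cc 5 = -dd 2 + dd 5 := by
    rw [cc_mul_cc]; norm_num [dd_reduce, dd_neg, dd_zero]; ring
  have h36 : cc 3 * cc 6 = -dd 3 + dd 4 := by
    rw [cc_mul_cc]; norm_num [dd_reduce, dd_neg, dd_zero]; ring
  have h44 : cc 4 * cc 4 = dd 5 - 2 := by
    rw [cc_mul_cc]; norm_num [dd_reduce, dd_neg, dd_zero]
  have h45 : cc 4 * cc 5 = -dd 1 + dd 4 := by
    rw [cc_mul_cc]; norm_num [dd_reduce, dd_neg, dd_zero]; ring
  have h46 : cc 4 * cc 6 = -dd 2 + dd 3 := by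
    rw [cc_mul_cc]; norm_num [dd_reduce, dd_neg, dd_zero]; ring
  have h55 : cc 5 * cc 5 = dd 3 - 2 := by
    rw [cc_mul_cc]; norm_num [dd_reduce, dd_neg, dd_zero]
  have h56 : cc 5 * cc 6 = -dd 1 + dd 2 := by
    rw [cc_mul_cc]; norm_num [dd_reduce, dd_neg, dd_zero]; ring
  have h66 : cc 6 * cc 6 = dd 1 - 2 := by
    rw [cc_mul_cc]; norm_num [dd_reduce, dd_neg, dd_zero]
  simp only [AA0, AA1, AA2, AA3, AA4, AA5, AA6, toVec, Fin.isValue, Matrix.cons_val,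
    weilS_apply_two hf, weilS_apply_six hf, weilS_apply_five hf, weilS_apply_three hf,
    weilS_apply_nine hf, weilS_apply_one hf, hf.apply_nine]
  linear_combination (-f 1 * f 5 - f 2 * f 3 + f 4 * f 6) * h11 + (f 1 * f 3 - f 1 * f 4 - f 2 * f
  5 - f 2 * f 6 - f 3 * f 4 - f 5 * f 6) * h12 + (-f 1 * f 2 - f 1 * f 6 + f 2 * f 4 - f 3 * f 5 -
  f 3 * f 6 + f 4 * f 5) * h13 + (f 1 * f 2 + f 1 * f 6 - f 2 * f 4 + f 3 * f 5 + f 3 * f 6 - f 4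
  * f 5) * h14 + (f 1 * f 1 - f 2 * f 2 + f 3 * f 3 + f 4 * f 4 - f 5 * f 5 - f 6 * f 6) * h15 +
  (f 1 * f 3 - f 1 * f 4 - f 2 * f 5 - f 2 * f 6 - f 3 * f 4 - f 5 * f 6) * h16 + (f 1 * f 5 + f 2
  * f 3 - f 4 * f 6) * h22 + (f 1 * f 1 - f 2 * f 2 + f 3 * f 3 + f 4 * f 4 - f 5 * f 5 - f 6 * f
  6) * h23 + (-f 1 * f 3 + f 1 * f 4 + f 2 * f 5 + f 2 * f 6 + f 3 * f 4 + f 5 * f 6) * h24 + (f 1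
  * f 2 + f 1 * f 6 - f 2 * f 4 + f 3 * f 5 + f 3 * f 6 - f 4 * f 5) * h25 + (f 1 * f 2 + f 1 * f
  6 - f 2 * f 4 + f 3 * f 5 + f 3 * f 6 - f 4 * f 5) * h26 + (-f 1 * f 5 - f 2 * f 3 + f 4 * f 6)
  * h33 + (f 1 * f 2 + f 1 * f 6 - f 2 * f 4 + f 3 * f 5 + f 3 * f 6 - f 4 * f 5) * h34 + (f 1 * f
  3 - f 1 * f 4 - f 2 * f 5 - f 2 * f 6 - f 3 * f 4 - f 5 * f 6) * h35 + (f 1 * f 3 - f 1 * f 4 -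
  f 2 * f 5 - f 2 * f 6 - f 3 * f 4 - f 5 * f 6) * h36 + (-f 1 * f 5 - f 2 * f 3 + f 4 * f 6) *
  h44 + (-f 1 * f 3 + f 1 * f 4 + f 2 * f 5 + f 2 * f 6 + f 3 * f 4 + f 5 * f 6) * h45 + (-f 1 * f
  1 + f 2 * f 2 - f 3 * f 3 - f 4 * f 4 + f 5 * f 5 + f 6 * f 6) * h46 + (f 1 * f 5 + f 2 * f 3 -
  f 4 * f 6) * h55 + (f 1 * f 2 + f 1 * f 6 - f 2 * f 4 + f 3 * f 5 + f 3 * f 6 - f 4 * f 5) * h56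
  + (f 1 * f 5 + f 2 * f 3 - f 4 * f 6) * h66 + (0) * hsum

/-- First linear combination of the cubic forms entering the transformation of `DD0`. -/
def cubicA (v : Fin 6 → ℂ) : ℂ :=
  -2 * DD0 v - DD1 v - DD2 v - DD3 v + DD4 v - DD5 v - DD6 v - DD9 v + DD10 v + DD12 v + 3 * DDinf
  v

/-- Second linear combination of the cubic forms entering the transformation of `DD0`. -/
def cubicB (v : Fin 6 → ℂ) : ℂ :=
  3 * DD0 v - DD1 v - DD3 v - DD4 v - DD7 v - DD8 v - DD9 v - DD10 v - DD11 v - DD12 v + 2 * DDinf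
  v

set_option maxHeartbeats 1000000 in
lemma DD0_DDinf_weilS {f : ZMod 13 → ℂ} (hf : f.Odd) :
    DD0 (toVec (weilS f)) = (cc 1 + cc 3 - cc 4) * cubicA (toVec f)
        + (cc 2 + cc 5 + cc 6) * cubicB (toVec f) ∧
      DDinf (toVec (weilS f)) = (cc 1 + cc 3 - cc 4) * cubicB (toVec f)
        - (cc 2 + cc 5 + cc 6) * cubicA (toVec f) := by
  have h111 : cc 1 * cc 1 * cc 1 = -3 * cc 1 + cc 3 := by
    rw [cc_mul_cc_mul_cc]; norm_num [cc_reduce, cc_neg, cc_zero, cc_thirteen]; ring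
  have h112 : cc 1 * cc 1 * cc 2 = -2 * cc 2 + cc 4 := by
    rw [cc_mul_cc_mul_cc]; norm_num [cc_reduce, cc_neg, cc_zero, cc_thirteen]; ring
  have h113 : cc 1 * cc 1 * cc 3 = cc 1 - 2 * cc 3 + cc 5 := by
    rw [cc_mul_cc_mul_cc]; norm_num [cc_reduce, cc_neg, cc_zero, cc_thirteen]; ring
  have h114 : cc 1 * cc 1 * cc 4 = cc 2 - 2 * cc 4 + cc 6 := by
    rw [cc_mul_cc_mul_cc]; norm_num [cc_reduce, cc_neg, cc_zero, cc_thirteen]; ring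
  have h115 : cc 1 * cc 1 * cc 5 = cc 3 - 2 * cc 5 - cc 6 := by
    rw [cc_mul_cc_mul_cc]; norm_num [cc_reduce, cc_neg, cc_zero, cc_thirteen]; ring
  have h116 : cc 1 * cc 1 * cc 6 = cc 4 - cc 5 - 2 * cc 6 := by
    rw [cc_mul_cc_mul_cc]; norm_num [cc_reduce, cc_neg, cc_zero, cc_thirteen]; ring
  have h122 : cc 1 * cc 2 * cc 2 = -2 * cc 1 - cc 3 + cc 5 := by
    rw [cc_mul_cc_mul_cc]; norm_num [cc_reduce, cc_neg, cc_zero, cc_thirteen]; ring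
  have h123 : cc 1 * cc 2 * cc 3 = -cc 2 - cc 4 + cc 6 := by
    rw [cc_mul_cc_mul_cc]; norm_num [cc_reduce, cc_neg, cc_zero, cc_thirteen]; ring
  have h124 : cc 1 * cc 2 * cc 4 = cc 1 - cc 3 - cc 5 - cc 6 := by
    rw [cc_mul_cc_mul_cc]; norm_num [cc_reduce, cc_neg, cc_zero, cc_thirteen]; ring
  have h125 : cc 1 * cc 2 * cc 5 = cc 2 - cc 4 - cc 5 - cc 6 := by
    rw [cc_mul_cc_mul_cc]; norm_num [cc_reduce, cc_neg, cc_zero, cc_thirteen]; ring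
  have h126 : cc 1 * cc 2 * cc 6 = cc 3 - cc 4 - cc 5 + cc 6 := by
    rw [cc_mul_cc_mul_cc]; norm_num [cc_reduce, cc_neg, cc_zero, cc_thirteen]; ring
  have h133 : cc 1 * cc 3 * cc 3 = -2 * cc 1 - cc 5 - cc 6 := by
    rw [cc_mul_cc_mul_cc]; norm_num [cc_reduce, cc_neg, cc_zero, cc_thirteen]; ring
  have h134 : cc 1 * cc 3 * cc 4 = -cc 2 - cc 5 - cc 6 := by
    rw [cc_mul_cc_mul_cc]; norm_num [cc_reduce, cc_neg, cc_zero, cc_thirteen]; ring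
  have h135 : cc 1 * cc 3 * cc 5 = cc 1 - cc 3 - cc 4 + cc 6 := by
    rw [cc_mul_cc_mul_cc]; norm_num [cc_reduce, cc_neg, cc_zero, cc_thirteen]; ring
  have h136 : cc 1 * cc 3 * cc 6 = cc 2 - cc 3 - cc 4 + cc 5 := by
    rw [cc_mul_cc_mul_cc]; norm_num [cc_reduce, cc_neg, cc_zero, cc_thirteen]; ring
  have h144 : cc 1 * cc 4 * cc 4 = -2 * cc 1 - cc 4 + cc 6 := by
    rw [cc_mul_cc_mul_cc]; norm_num [cc_reduce, cc_neg, cc_zero, cc_thirteen]; ring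
  have h145 : cc 1 * cc 4 * cc 5 = -cc 2 - cc 3 + cc 5 := by
    rw [cc_mul_cc_mul_cc]; norm_num [cc_reduce, cc_neg, cc_zero, cc_thirteen]; ring
  have h146 : cc 1 * cc 4 * cc 6 = cc 1 - cc 2 - cc 3 + cc 4 := by
    rw [cc_mul_cc_mul_cc]; norm_num [cc_reduce, cc_neg, cc_zero, cc_thirteen]; ring
  have h155 : cc 1 * cc 5 * cc 5 = -2 * cc 1 - cc 2 + cc 4 := by
    rw [cc_mul_cc_mul_cc]; norm_num [cc_reduce, cc_neg, cc_zero, cc_thirteen]; ring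
  have h156 : cc 1 * cc 5 * cc 6 = -cc 1 - cc 2 + cc 3 := by
    rw [cc_mul_cc_mul_cc]; norm_num [cc_reduce, cc_neg, cc_zero, cc_thirteen]
  have h166 : cc 1 * cc 6 * cc 6 = -2 * cc 1 + cc 2 := by
    rw [cc_mul_cc_mul_cc]; norm_num [cc_reduce, cc_neg, cc_zero, cc_thirteen]; ring
  have h222 : cc 2 * cc 2 * cc 2 = -3 * cc 2 + cc 6 := by
    rw [cc_mul_cc_mul_cc]; norm_num [cc_reduce, cc_neg, cc_zero, cc_thirteen]; ring
  have h223 : cc 2 * cc 2 * cc 3 = -cc 1 - 2 * cc 3 - cc 6 := by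
    rw [cc_mul_cc_mul_cc]; norm_num [cc_reduce, cc_neg, cc_zero, cc_thirteen]; ring
  have h224 : cc 2 * cc 2 * cc 4 = -2 * cc 4 - cc 5 := by
    rw [cc_mul_cc_mul_cc]; norm_num [cc_reduce, cc_neg, cc_zero, cc_thirteen]; ring
  have h225 : cc 2 * cc 2 * cc 5 = cc 1 - cc 4 - 2 * cc 5 := by
    rw [cc_mul_cc_mul_cc]; norm_num [cc_reduce, cc_neg, cc_zero, cc_thirteen]; ring
  have h226 : cc 2 * cc 2 * cc 6 = cc 2 - cc 3 - 2 * cc 6 := by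
    rw [cc_mul_cc_mul_cc]; norm_num [cc_reduce, cc_neg, cc_zero, cc_thirteen]; ring
  have h233 : cc 2 * cc 3 * cc 3 = -2 * cc 2 - cc 4 - cc 5 := by
    rw [cc_mul_cc_mul_cc]; norm_num [cc_reduce, cc_neg, cc_zero, cc_thirteen]; ring
  have h234 : cc 2 * cc 3 * cc 4 = -cc 1 - cc 3 - cc 4 - cc 5 := by
    rw [cc_mul_cc_mul_cc]; norm_num [cc_reduce, cc_neg, cc_zero, cc_thirteen]; ring
  have h235 : cc 2 * cc 3 * cc 5 = -cc 3 - cc 4 - cc 6 := by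
    rw [cc_mul_cc_mul_cc]; norm_num [cc_reduce, cc_neg, cc_zero, cc_thirteen]; ring
  have h236 : cc 2 * cc 3 * cc 6 = cc 1 - cc 2 - cc 5 + cc 6 := by
    rw [cc_mul_cc_mul_cc]; norm_num [cc_reduce, cc_neg, cc_zero, cc_thirteen]; ring
  have h244 : cc 2 * cc 4 * cc 4 = -2 * cc 2 - cc 3 - cc 6 := by
    rw [cc_mul_cc_mul_cc]; norm_num [cc_reduce, cc_neg, cc_zero, cc_thirteen]; ring
  have h245 : cc 2 * cc 4 * cc 5 = -cc 1 - cc 2 - cc 3 + cc 6 := by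
    rw [cc_mul_cc_mul_cc]; norm_num [cc_reduce, cc_neg, cc_zero, cc_thirteen]; ring
  have h246 : cc 2 * cc 4 * cc 6 = -cc 1 - cc 4 + cc 5 := by
    rw [cc_mul_cc_mul_cc]; norm_num [cc_reduce, cc_neg, cc_zero, cc_thirteen]
  have h255 : cc 2 * cc 5 * cc 5 = -cc 1 - 2 * cc 2 + cc 5 := by
    rw [cc_mul_cc_mul_cc]; norm_num [cc_reduce, cc_neg, cc_zero, cc_thirteen]; ring
  have h256 : cc 2 * cc 5 * cc 6 = -cc 1 - cc 3 + cc 4 := by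
    rw [cc_mul_cc_mul_cc]; norm_num [cc_reduce, cc_neg, cc_zero, cc_thirteen]
  have h266 : cc 2 * cc 6 * cc 6 = cc 1 - 2 * cc 2 + cc 3 := by
    rw [cc_mul_cc_mul_cc]; norm_num [cc_reduce, cc_neg, cc_zero, cc_thirteen]; ring
  have h333 : cc 3 * cc 3 * cc 3 = -3 * cc 3 - cc 4 := by
    rw [cc_mul_cc_mul_cc]; norm_num [cc_reduce, cc_neg, cc_zero, cc_thirteen]; ring
  have h334 : cc 3 * cc 3 * cc 4 = -cc 2 - cc 3 - 2 * cc 4 := by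
    rw [cc_mul_cc_mul_cc]; norm_num [cc_reduce, cc_neg, cc_zero, cc_thirteen]; ring
  have h335 : cc 3 * cc 3 * cc 5 = -cc 1 - cc 2 - 2 * cc 5 := by
    rw [cc_mul_cc_mul_cc]; norm_num [cc_reduce, cc_neg, cc_zero, cc_thirteen]; ring
  have h336 : cc 3 * cc 3 * cc 6 = -cc 1 - 2 * cc 6 := by
    rw [cc_mul_cc_mul_cc]; norm_num [cc_reduce, cc_neg, cc_zero, cc_thirteen]; ring
  have h344 : cc 3 * cc 4 * cc 4 = -cc 2 - 2 * cc 3 - cc 5 := by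
    rw [cc_mul_cc_mul_cc]; norm_num [cc_reduce, cc_neg, cc_zero, cc_thirteen]; ring
  have h345 : cc 3 * cc 4 * cc 5 = -cc 1 - cc 2 - cc 4 - cc 6 := by
    rw [cc_mul_cc_mul_cc]; norm_num [cc_reduce, cc_neg, cc_zero, cc_thirteen]; ring
  have h346 : cc 3 * cc 4 * cc 6 = -cc 1 - cc 5 + cc 6 := by
    rw [cc_mul_cc_mul_cc]; norm_num [cc_reduce, cc_neg, cc_zero, cc_thirteen]
  have h355 : cc 3 * cc 5 * cc 5 = -2 * cc 3 + cc 6 := by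
    rw [cc_mul_cc_mul_cc]; norm_num [cc_reduce, cc_neg, cc_zero, cc_thirteen]; ring
  have h356 : cc 3 * cc 5 * cc 6 = cc 1 - cc 2 - cc 4 + cc 5 := by
    rw [cc_mul_cc_mul_cc]; norm_num [cc_reduce, cc_neg, cc_zero, cc_thirteen]
  have h366 : cc 3 * cc 6 * cc 6 = cc 2 - 2 * cc 3 + cc 4 := by
    rw [cc_mul_cc_mul_cc]; norm_num [cc_reduce, cc_neg, cc_zero, cc_thirteen]; ring
  have h444 : cc 4 * cc 4 * cc 4 = -cc 1 - 3 * cc 4 := by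
    rw [cc_mul_cc_mul_cc]; norm_num [cc_reduce, cc_neg, cc_zero, cc_thirteen]; ring
  have h445 : cc 4 * cc 4 * cc 5 = -cc 3 - 2 * cc 5 := by
    rw [cc_mul_cc_mul_cc]; norm_num [cc_reduce, cc_neg, cc_zero, cc_thirteen]; ring
  have h446 : cc 4 * cc 4 * cc 6 = cc 1 - cc 2 - 2 * cc 6 := by
    rw [cc_mul_cc_mul_cc]; norm_num [cc_reduce, cc_neg, cc_zero, cc_thirteen]; ring
  have h455 : cc 4 * cc 5 * cc 5 = cc 1 - 2 * cc 4 - cc 6 := by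
    rw [cc_mul_cc_mul_cc]; norm_num [cc_reduce, cc_neg, cc_zero, cc_thirteen]; ring
  have h456 : cc 4 * cc 5 * cc 6 = cc 2 - cc 3 - cc 5 + cc 6 := by
    rw [cc_mul_cc_mul_cc]; norm_num [cc_reduce, cc_neg, cc_zero, cc_thirteen]
  have h466 : cc 4 * cc 6 * cc 6 = cc 3 - 2 * cc 4 + cc 5 := by
    rw [cc_mul_cc_mul_cc]; norm_num [cc_reduce, cc_neg, cc_zero, cc_thirteen]; ring
  have h555 : cc 5 * cc 5 * cc 5 = cc 2 - 3 * cc 5 := by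
    rw [cc_mul_cc_mul_cc]; norm_num [cc_reduce, cc_neg, cc_zero, cc_thirteen]; ring
  have h556 : cc 5 * cc 5 * cc 6 = cc 3 - cc 4 - 2 * cc 6 := by
    rw [cc_mul_cc_mul_cc]; norm_num [cc_reduce, cc_neg, cc_zero, cc_thirteen]; ring
  have h566 : cc 5 * cc 6 * cc 6 = cc 4 - 2 * cc 5 + cc 6 := by
    rw [cc_mul_cc_mul_cc]; norm_num [cc_reduce, cc_neg, cc_zero, cc_thirteen]; ring
  have h666 : cc 6 * cc 6 * cc 6 = cc 5 - 3 * cc 6 := by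
    rw [cc_mul_cc_mul_cc]; norm_num [cc_reduce, cc_neg, cc_zero, cc_thirteen]; ring
  simp only [cubicA, cubicB, DD0, DD1, DD2, DD3, DD4, DD5, DD6, DD7, DD8, DD9, DD10, DD11, DD12,
    DDinf, toVec, Fin.isValue, Matrix.cons_val,
    weilS_apply_two hf, weilS_apply_six hf, weilS_apply_five hf, weilS_apply_three hf,
    weilS_apply_nine hf, weilS_apply_one hf, hf.apply_nine]
  constructor
  · linear_combination (f 2 * f 5 * f 6) * h111 + (-f 1 * f 2 * f 5 - f 2 * f 3 * f 6 + f 4 * f 5 *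
  f 6) * h112 + (f 2 * f 2 * f 6 + f 2 * f 5 * f 5 + f 5 * f 6 * f 6) * h113 + (-f 2 * f 2 * f 5 -
  f 2 * f 6 * f 6 - f 5 * f 5 * f 6) * h114 + (-f 1 * f 2 * f 6 + f 2 * f 4 * f 5 - f 3 * f 5 * f
  6) * h115 + (-f 1 * f 5 * f 6 - f 2 * f 3 * f 5 + f 2 * f 4 * f 6) * h116 + (f 1 * f 2 * f 3 - f
  1 * f 4 * f 5 - f 3 * f 4 * f 6) * h122 + (-f 1 * f 2 * f 2 - f 1 * f 5 * f 6 - f 2 * f 3 * f 5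
  + f 2 * f 4 * f 6 - f 3 * f 6 * f 6 + f 4 * f 5 * f 5) * h123 + (f 1 * f 2 * f 6 + f 1 * f 5 * f
  5 + f 2 * f 2 * f 3 - f 2 * f 4 * f 5 + f 3 * f 5 * f 6 - f 4 * f 6 * f 6) * h124 + (f 1 * f 1 *
  f 2 + f 1 * f 3 * f 5 - f 1 * f 4 * f 6 - f 2 * f 3 * f 4 + f 3 * f 3 * f 6 + f 4 * f 4 * f 5) *
  h125 + (f 1 * f 1 * f 5 - f 1 * f 2 * f 4 + f 1 * f 3 * f 6 + f 2 * f 3 * f 3 - f 3 * f 4 * f 5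
  + f 4 * f 4 * f 6) * h126 + (f 2 * f 2 * f 5 + f 2 * f 6 * f 6 + f 5 * f 5 * f 6) * h133 + (-f 2
  * f 2 * f 2 - 3 * f 2 * f 5 * f 6 - f 5 * f 5 * f 5 - f 6 * f 6 * f 6) * h134 + (-f 1 * f 2 * f
  5 - f 1 * f 6 * f 6 + f 2 * f 2 * f 4 - f 2 * f 3 * f 6 - f 3 * f 5 * f 5 + f 4 * f 5 * f 6) *
  h135 + (-f 1 * f 2 * f 6 - f 1 * f 5 * f 5 - f 2 * f 2 * f 3 + f 2 * f 4 * f 5 - f 3 * f 5 * f 6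
  + f 4 * f 6 * f 6) * h136 + (f 2 * f 2 * f 6 + f 2 * f 5 * f 5 + f 5 * f 6 * f 6) * h144 + (f 1
  * f 2 * f 2 + f 1 * f 5 * f 6 + f 2 * f 3 * f 5 - f 2 * f 4 * f 6 + f 3 * f 6 * f 6 - f 4 * f 5
  * f 5) * h145 + (f 1 * f 2 * f 5 + f 1 * f 6 * f 6 - f 2 * f 2 * f 4 + f 2 * f 3 * f 6 + f 3 * f
  5 * f 5 - f 4 * f 5 * f 6) * h146 + (-f 1 * f 2 * f 4 + f 1 * f 3 * f 6 - f 3 * f 4 * f 5) *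
  h155 + (f 1 * f 1 * f 6 + f 1 * f 2 * f 3 - f 1 * f 4 * f 5 + f 2 * f 4 * f 4 + f 3 * f 3 * f 5
  - f 3 * f 4 * f 6) * h156 + (f 1 * f 3 * f 5 - f 1 * f 4 * f 6 - f 2 * f 3 * f 4) * h166 + (f 1
  * f 3 * f 4) * h222 + (-f 1 * f 2 * f 4 + f 1 * f 3 * f 6 - f 3 * f 4 * f 5) * h223 + (-f 1 * f
  3 * f 5 + f 1 * f 4 * f 6 + f 2 * f 3 * f 4) * h224 + (f 1 * f 1 * f 4 - f 1 * f 3 * f 3 - f 3 *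
  f 4 * f 4) * h225 + (-f 1 * f 1 * f 3 - f 1 * f 4 * f 4 + f 3 * f 3 * f 4) * h226 + (-f 1 * f 2
  * f 6 + f 2 * f 4 * f 5 - f 3 * f 5 * f 6) * h233 + (f 1 * f 2 * f 5 + f 1 * f 6 * f 6 - f 2 * f
  2 * f 4 + f 2 * f 3 * f 6 + f 3 * f 5 * f 5 - f 4 * f 5 * f 6) * h234 + (f 1 * f 1 * f 6 + f 1 *
  f 2 * f 3 - f 1 * f 4 * f 5 + f 2 * f 4 * f 4 + f 3 * f 3 * f 5 - f 3 * f 4 * f 6) * h235 + (f 1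
  * f 1 * f 2 + f 1 * f 3 * f 5 - f 1 * f 4 * f 6 - f 2 * f 3 * f 4 + f 3 * f 3 * f 6 + f 4 * f 4
  * f 5) * h236 + (-f 1 * f 5 * f 6 - f 2 * f 3 * f 5 + f 2 * f 4 * f 6) * h244 + (-f 1 * f 1 * f
  5 + f 1 * f 2 * f 4 - f 1 * f 3 * f 6 - f 2 * f 3 * f 3 + f 3 * f 4 * f 5 - f 4 * f 4 * f 6) *
  h245 + (-f 1 * f 1 * f 6 - f 1 * f 2 * f 3 + f 1 * f 4 * f 5 - f 2 * f 4 * f 4 - f 3 * f 3 * f 5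
  + f 3 * f 4 * f 6) * h246 + (-f 1 * f 1 * f 3 - f 1 * f 4 * f 4 + f 3 * f 3 * f 4) * h255 + (-f
  1 * f 1 * f 1 + 3 * f 1 * f 3 * f 4 - f 3 * f 3 * f 3 + f 4 * f 4 * f 4) * h256 + (f 1 * f 1 * f
  4 - f 1 * f 3 * f 3 - f 3 * f 4 * f 4) * h266 + (f 2 * f 5 * f 6) * h333 + (-f 2 * f 2 * f 6 - f
  2 * f 5 * f 5 - f 5 * f 6 * f 6) * h334 + (-f 1 * f 5 * f 6 - f 2 * f 3 * f 5 + f 2 * f 4 * f 6)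
  * h335 + (-f 1 * f 2 * f 5 - f 2 * f 3 * f 6 + f 4 * f 5 * f 6) * h336 + (f 2 * f 2 * f 5 + f 2
  * f 6 * f 6 + f 5 * f 5 * f 6) * h344 + (f 1 * f 2 * f 6 + f 1 * f 5 * f 5 + f 2 * f 2 * f 3 - f
  2 * f 4 * f 5 + f 3 * f 5 * f 6 - f 4 * f 6 * f 6) * h345 + (f 1 * f 2 * f 2 + f 1 * f 5 * f 6 +
  f 2 * f 3 * f 5 - f 2 * f 4 * f 6 + f 3 * f 6 * f 6 - f 4 * f 5 * f 5) * h346 + (f 1 * f 3 * f 5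
  - f 1 * f 4 * f 6 - f 2 * f 3 * f 4) * h355 + (f 1 * f 1 * f 5 - f 1 * f 2 * f 4 + f 1 * f 3 * f
  6 + f 2 * f 3 * f 3 - f 3 * f 4 * f 5 + f 4 * f 4 * f 6) * h356 + (f 1 * f 2 * f 3 - f 1 * f 4 *
  f 5 - f 3 * f 4 * f 6) * h366 + (-f 2 * f 5 * f 6) * h444 + (-f 1 * f 2 * f 5 - f 2 * f 3 * f 6
  + f 4 * f 5 * f 6) * h445 + (-f 1 * f 2 * f 6 + f 2 * f 4 * f 5 - f 3 * f 5 * f 6) * h446 + (-f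
  1 * f 2 * f 3 + f 1 * f 4 * f 5 + f 3 * f 4 * f 6) * h455 + (-f 1 * f 1 * f 2 - f 1 * f 3 * f 5
  + f 1 * f 4 * f 6 + f 2 * f 3 * f 4 - f 3 * f 3 * f 6 - f 4 * f 4 * f 5) * h456 + (f 1 * f 2 * f
  4 - f 1 * f 3 * f 6 + f 3 * f 4 * f 5) * h466 + (f 1 * f 3 * f 4) * h555 + (f 1 * f 1 * f 4 - f
  1 * f 3 * f 3 - f 3 * f 4 * f 4) * h556 + (-f 1 * f 1 * f 3 - f 1 * f 4 * f 4 + f 3 * f 3 * f 4)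
  * h566 + (f 1 * f 3 * f 4) * h666
  · linear_combination (f 1 * f 3 * f 4) * h111 + (-f 1 * f 3 * f 5 + f 1 * f 4 * f 6 + f 2 * f 3 *
  f 4) * h112 + (-f 1 * f 1 * f 3 - f 1 * f 4 * f 4 + f 3 * f 3 * f 4) * h113 + (-f 1 * f 1 * f 4
  + f 1 * f 3 * f 3 + f 3 * f 4 * f 4) * h114 + (f 1 * f 2 * f 4 - f 1 * f 3 * f 6 + f 3 * f 4 * f
  5) * h115 + (-f 1 * f 2 * f 3 + f 1 * f 4 * f 5 + f 3 * f 4 * f 6) * h116 + (-f 1 * f 5 * f 6 -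
  f 2 * f 3 * f 5 + f 2 * f 4 * f 6) * h122 + (-f 1 * f 1 * f 6 - f 1 * f 2 * f 3 + f 1 * f 4 * f
  5 - f 2 * f 4 * f 4 - f 3 * f 3 * f 5 + f 3 * f 4 * f 6) * h123 + (f 1 * f 1 * f 5 - f 1 * f 2 *
  f 4 + f 1 * f 3 * f 6 + f 2 * f 3 * f 3 - f 3 * f 4 * f 5 + f 4 * f 4 * f 6) * h124 + (-f 1 * f
  2 * f 5 - f 1 * f 6 * f 6 + f 2 * f 2 * f 4 - f 2 * f 3 * f 6 - f 3 * f 5 * f 5 + f 4 * f 5 * f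
  6) * h125 + (-f 1 * f 2 * f 6 - f 1 * f 5 * f 5 - f 2 * f 2 * f 3 + f 2 * f 4 * f 5 - f 3 * f 5
  * f 6 + f 4 * f 6 * f 6) * h126 + (f 1 * f 1 * f 4 - f 1 * f 3 * f 3 - f 3 * f 4 * f 4) * h133 +
  (f 1 * f 1 * f 1 - 3 * f 1 * f 3 * f 4 + f 3 * f 3 * f 3 - f 4 * f 4 * f 4) * h134 + (-f 1 * f 1
  * f 2 - f 1 * f 3 * f 5 + f 1 * f 4 * f 6 + f 2 * f 3 * f 4 - f 3 * f 3 * f 6 - f 4 * f 4 * f 5)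
  * h135 + (-f 1 * f 1 * f 5 + f 1 * f 2 * f 4 - f 1 * f 3 * f 6 - f 2 * f 3 * f 3 + f 3 * f 4 * f
  5 - f 4 * f 4 * f 6) * h136 + (-f 1 * f 1 * f 3 - f 1 * f 4 * f 4 + f 3 * f 3 * f 4) * h144 + (f
  1 * f 1 * f 6 + f 1 * f 2 * f 3 - f 1 * f 4 * f 5 + f 2 * f 4 * f 4 + f 3 * f 3 * f 5 - f 3 * f
  4 * f 6) * h145 + (f 1 * f 1 * f 2 + f 1 * f 3 * f 5 - f 1 * f 4 * f 6 - f 2 * f 3 * f 4 + f 3 *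
  f 3 * f 6 + f 4 * f 4 * f 5) * h146 + (-f 1 * f 2 * f 6 + f 2 * f 4 * f 5 - f 3 * f 5 * f 6) *
  h155 + (-f 1 * f 2 * f 2 - f 1 * f 5 * f 6 - f 2 * f 3 * f 5 + f 2 * f 4 * f 6 - f 3 * f 6 * f 6
  + f 4 * f 5 * f 5) * h156 + (-f 1 * f 2 * f 5 - f 2 * f 3 * f 6 + f 4 * f 5 * f 6) * h166 + (-f
  2 * f 5 * f 6) * h222 + (-f 1 * f 2 * f 6 + f 2 * f 4 * f 5 - f 3 * f 5 * f 6) * h223 + (f 1 * f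
  2 * f 5 + f 2 * f 3 * f 6 - f 4 * f 5 * f 6) * h224 + (-f 2 * f 2 * f 5 - f 2 * f 6 * f 6 - f 5
  * f 5 * f 6) * h225 + (-f 2 * f 2 * f 6 - f 2 * f 5 * f 5 - f 5 * f 6 * f 6) * h226 + (f 1 * f 2
  * f 4 - f 1 * f 3 * f 6 + f 3 * f 4 * f 5) * h233 + (f 1 * f 1 * f 2 + f 1 * f 3 * f 5 - f 1 * f
  4 * f 6 - f 2 * f 3 * f 4 + f 3 * f 3 * f 6 + f 4 * f 4 * f 5) * h234 + (-f 1 * f 2 * f 2 - f 1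
  * f 5 * f 6 - f 2 * f 3 * f 5 + f 2 * f 4 * f 6 - f 3 * f 6 * f 6 + f 4 * f 5 * f 5) * h235 +
  (-f 1 * f 2 * f 5 - f 1 * f 6 * f 6 + f 2 * f 2 * f 4 - f 2 * f 3 * f 6 - f 3 * f 5 * f 5 + f 4
  * f 5 * f 6) * h236 + (-f 1 * f 2 * f 3 + f 1 * f 4 * f 5 + f 3 * f 4 * f 6) * h244 + (f 1 * f 2
  * f 6 + f 1 * f 5 * f 5 + f 2 * f 2 * f 3 - f 2 * f 4 * f 5 + f 3 * f 5 * f 6 - f 4 * f 6 * f 6)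
  * h245 + (f 1 * f 2 * f 2 + f 1 * f 5 * f 6 + f 2 * f 3 * f 5 - f 2 * f 4 * f 6 + f 3 * f 6 * f
  6 - f 4 * f 5 * f 5) * h246 + (-f 2 * f 2 * f 6 - f 2 * f 5 * f 5 - f 5 * f 6 * f 6) * h255 +
  (-f 2 * f 2 * f 2 - 3 * f 2 * f 5 * f 6 - f 5 * f 5 * f 5 - f 6 * f 6 * f 6) * h256 + (-f 2 * f
  2 * f 5 - f 2 * f 6 * f 6 - f 5 * f 5 * f 6) * h266 + (f 1 * f 3 * f 4) * h333 + (f 1 * f 1 * f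
  3 + f 1 * f 4 * f 4 - f 3 * f 3 * f 4) * h334 + (-f 1 * f 2 * f 3 + f 1 * f 4 * f 5 + f 3 * f 4
  * f 6) * h335 + (-f 1 * f 3 * f 5 + f 1 * f 4 * f 6 + f 2 * f 3 * f 4) * h336 + (f 1 * f 1 * f 4
  - f 1 * f 3 * f 3 - f 3 * f 4 * f 4) * h344 + (f 1 * f 1 * f 5 - f 1 * f 2 * f 4 + f 1 * f 3 * f
  6 + f 2 * f 3 * f 3 - f 3 * f 4 * f 5 + f 4 * f 4 * f 6) * h345 + (f 1 * f 1 * f 6 + f 1 * f 2 *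
  f 3 - f 1 * f 4 * f 5 + f 2 * f 4 * f 4 + f 3 * f 3 * f 5 - f 3 * f 4 * f 6) * h346 + (-f 1 * f
  2 * f 5 - f 2 * f 3 * f 6 + f 4 * f 5 * f 6) * h355 + (-f 1 * f 2 * f 6 - f 1 * f 5 * f 5 - f 2
  * f 2 * f 3 + f 2 * f 4 * f 5 - f 3 * f 5 * f 6 + f 4 * f 6 * f 6) * h356 + (-f 1 * f 5 * f 6 -
  f 2 * f 3 * f 5 + f 2 * f 4 * f 6) * h366 + (-f 1 * f 3 * f 4) * h444 + (-f 1 * f 3 * f 5 + f 1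
  * f 4 * f 6 + f 2 * f 3 * f 4) * h445 + (f 1 * f 2 * f 4 - f 1 * f 3 * f 6 + f 3 * f 4 * f 5) *
  h446 + (f 1 * f 5 * f 6 + f 2 * f 3 * f 5 - f 2 * f 4 * f 6) * h455 + (f 1 * f 2 * f 5 + f 1 * f
  6 * f 6 - f 2 * f 2 * f 4 + f 2 * f 3 * f 6 + f 3 * f 5 * f 5 - f 4 * f 5 * f 6) * h456 + (f 1 *
  f 2 * f 6 - f 2 * f 4 * f 5 + f 3 * f 5 * f 6) * h466 + (-f 2 * f 5 * f 6) * h555 + (-f 2 * f 2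
  * f 5 - f 2 * f 6 * f 6 - f 5 * f 5 * f 6) * h556 + (-f 2 * f 2 * f 6 - f 2 * f 5 * f 5 - f 5 *
  f 6 * f 6) * h566 + (-f 2 * f 5 * f 6) * h666

lemma cubicA_sq_add_cubicB_sq (v : Fin 6 → ℂ) :
    cubicA v ^ 2 + cubicB v ^ 2 = -(-13 * GG0 v + GG1 v + GG2 v + GG3 v + GG4 v + GG5 v + GG6 v + GG7 v + GG8 v + GG9 v + GG10 v + GG11 v + GG12 v) := by
  simp only [cubicA, cubicB, GG0, GG1, GG2, GG3, GG4, GG5, GG6, GG7, GG8, GG9, GG10, GG11, GG12]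
  ring

lemma cc_gauss : (cc 1 + cc 3 - cc 4) ^ 2 + (cc 2 + cc 5 + cc 6) ^ 2 = -13 := by
  have hsum := one_add_sum_dd
  have h11 : cc 1 * cc 1 = dd 2 - 2 := by
    rw [cc_mul_cc]; norm_num [dd_reduce, dd_neg, dd_zero]
  have h13 : cc 1 * cc 3 = -dd 2 + dd 4 := by
    rw [cc_mul_cc]; norm_num [dd_reduce, dd_neg, dd_zero]; ring
  have h14 : cc 1 * cc 4 = -dd 3 + dd 5 := by
    rw [cc_mul_cc]; norm_num [dd_reduce, dd_neg, dd_zero]; ring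
  have h22 : cc 2 * cc 2 = dd 4 - 2 := by
    rw [cc_mul_cc]; norm_num [dd_reduce, dd_neg, dd_zero]
  have h25 : cc 2 * cc 5 = -dd 3 + dd 6 := by
    rw [cc_mul_cc]; norm_num [dd_reduce, dd_neg, dd_zero]; ring
  have h26 : cc 2 * cc 6 = -dd 4 + dd 5 := by
    rw [cc_mul_cc]; norm_num [dd_reduce, dd_neg, dd_zero]; ring
  have h33 : cc 3 * cc 3 = dd 6 - 2 := by
    rw [cc_mul_cc]; norm_num [dd_reduce, dd_neg, dd_zero]
  have h34 : cc 3 * cc 4 = -dd 1 + dd 6 := by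
    rw [cc_mul_cc]; norm_num [dd_reduce, dd_neg, dd_zero]; ring
  have h44 : cc 4 * cc 4 = dd 5 - 2 := by
    rw [cc_mul_cc]; norm_num [dd_reduce, dd_neg, dd_zero]
  have h55 : cc 5 * cc 5 = dd 3 - 2 := by
    rw [cc_mul_cc]; norm_num [dd_reduce, dd_neg, dd_zero]
  have h56 : cc 5 * cc 6 = -dd 1 + dd 2 := by
    rw [cc_mul_cc]; norm_num [dd_reduce, dd_neg, dd_zero]; ring
  have h66 : cc 6 * cc 6 = dd 1 - 2 := by
    rw [cc_mul_cc]; norm_num [dd_reduce, dd_neg, dd_zero]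
  linear_combination h11 + h33 + h44 + 2 * h13 - 2 * h14 - 2 * h34 + h22 + h55 + h66 + 2 * h25
    + 2 * h26 + 2 * h56 + hsum

lemma dd_gauss : (dd 1 + dd 3 + dd 4 - dd 2 - dd 5 - dd 6) ^ 2 = 13 := by
  have h := gaussG_sq (ν := 1) (by decide)
  have h2 : gaussG 1 = 1 + 2 * (dd 2 + dd 5 + dd 6) := by
    simp only [gaussG, sum_eq_cc_sum, dd, neg_sq,
      show (5 * 1 * 0 ^ 2 : ZMod 13) = 0 by decide, show (5 * 1 * 1 ^ 2 : ZMod 13) = 5 by decide,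
      show (5 * 1 * 2 ^ 2 : ZMod 13) = -6 by decide, show (5 * 1 * 3 ^ 2 : ZMod 13) = 6 by decide,
      show (5 * 1 * 4 ^ 2 : ZMod 13) = 2 by decide, show (5 * 1 * 5 ^ 2 : ZMod 13) = -5 by decide,
      show (5 * 1 * 6 ^ 2 : ZMod 13) = -2 by decide, AddChar.map_zero_eq_one]
    ring
  have h3 : gaussG 1 = -(dd 1 + dd 3 + dd 4 - dd 2 - dd 5 - dd 6) := by
    linear_combination h2 + one_add_sum_dd
  rw [← h, h3]
  ring

lemma AA0_weilS_sq {f : ZMod 13 → ℂ} (hf : f.Odd) :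
    AA0 (toVec (weilS f)) ^ 2 = 13 * wF 0 (toVec f) := by
  rw [AA0_weilS hf, mul_pow, dd_gauss, wF]
  simp

lemma GG0_weilS {f : ZMod 13 → ℂ} (hf : f.Odd) :
    GG0 (toVec (weilS f)) = 13 * dF 0 (toVec f) := by
  obtain ⟨h0, hinf⟩ := DD0_DDinf_weilS hf
  rw [GG0, h0, hinf, dF]
  simp only [mul_zero, pow_zero, one_mul]
  linear_combination (cubicA (toVec f) ^ 2 + cubicB (toVec f) ^ 2) * cc_gauss
    - 13 * cubicA_sq_add_cubicB_sq (toVec f)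

/-- The diagonal action of the translation on coordinate vectors. -/
def twist (u : ℂ) (v : Fin 6 → ℂ) : Fin 6 → ℂ :=
  ![u ^ 7 * v 0, u ^ 11 * v 1, u ^ 8 * v 2, u ^ 6 * v 3, u ^ 2 * v 4, u ^ 5 * v 5]

lemma AA0_twist (v : Fin 6 → ℂ) {u : ℂ} (hu : u ^ 13 = 1) :
    AA0 (twist u v) = AA0 v := by
  simp only [AA0, twist, Fin.isValue, Matrix.cons_val]
  linear_combination ((1) * v 0 * v 3 + (1) * v 1 * v 4 + (1) * v 2 * v 5) * hu

lemma AA1_twist (v : Fin 6 → ℂ) {u : ℂ} (hu : u ^ 13 = 1) :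
    AA1 (twist u v) = u * AA1 v := by
  simp only [AA1, twist, Fin.isValue, Matrix.cons_val]
  linear_combination ((u) * v 0 * v 0 - (u) * 2 * v 2 * v 3) * hu

lemma AA2_twist (v : Fin 6 → ℂ) {u : ℂ} (hu : u ^ 13 = 1) :
    AA2 (twist u v) = u ^ 4 * AA2 v := by
  simp only [AA2, twist, Fin.isValue, Matrix.cons_val]
  linear_combination (-(u ^ 4) * 2 * v 1 * v 3) * hu

lemma AA3_twist (v : Fin 6 → ℂ) {u : ℂ} (hu : u ^ 13 = 1) :
    AA3 (twist u v) = u ^ 9 * AA3 v := by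
  simp only [AA3, twist, Fin.isValue, Matrix.cons_val]
  linear_combination ((u ^ 9) * v 1 * v 1) * hu

lemma AA4_twist (v : Fin 6 → ℂ) {u : ℂ} (hu : u ^ 13 = 1) :
    AA4 (twist u v) = u ^ 3 * AA4 v := by
  simp only [AA4, twist, Fin.isValue, Matrix.cons_val]
  linear_combination ((u ^ 3) * v 2 * v 2 - (u ^ 3) * 2 * v 1 * v 5) * hu

lemma AA5_twist (v : Fin 6 → ℂ) {u : ℂ} (_ : u ^ 13 = 1) :
    AA5 (twist u v) = u ^ 12 * AA5 v := by
  simp only [AA5, twist, Fin.isValue, Matrix.cons_val]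
  ring

lemma AA6_twist (v : Fin 6 → ℂ) {u : ℂ} (_ : u ^ 13 = 1) :
    AA6 (twist u v) = u ^ 10 * AA6 v := by
  simp only [AA6, twist, Fin.isValue, Matrix.cons_val]
  ring

lemma DD0_twist (v : Fin 6 → ℂ) {u : ℂ} (hu : u ^ 13 = 1) :
    DD0 (twist u v) = DD0 v := by
  simp only [DD0, twist, Fin.isValue, Matrix.cons_val]
  linear_combination ((u ^ 13 + 1) * v 0 * v 1 * v 2) * hu

lemma DD1_twist (v : Fin 6 → ℂ) {u : ℂ} (hu : u ^ 13 = 1) :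
    DD1 (twist u v) = u * DD1 v := by
  simp only [DD1, twist, Fin.isValue, Matrix.cons_val]
  linear_combination ((u ^ 14 + u) * 2 * v 1 * v 2 * v 2 + (u ^ 14 + u) * v 1 * v 1 * v 5 - (u) *
  v 3 * v 3 * v 4 + (u) * v 0 * v 4 * v 5) * hu

lemma DD2_twist (v : Fin 6 → ℂ) {u : ℂ} (hu : u ^ 13 = 1) :
    DD2 (twist u v) = u ^ 2 * DD2 v := by
  simp only [DD2, twist, Fin.isValue, Matrix.cons_val]
  linear_combination (-(u ^ 2) * v 5 * v 5 * v 5 + (u ^ 15 + u ^ 2) * v 1 * v 1 * v 3 - (u ^ 2) *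
  2 * v 1 * v 4 * v 4 + (u ^ 2) * v 0 * v 3 * v 4 + (u ^ 2) * 3 * v 2 * v 4 * v 5) * hu

lemma DD3_twist (v : Fin 6 → ℂ) {u : ℂ} (hu : u ^ 13 = 1) :
    DD3 (twist u v) = u ^ 3 * DD3 v := by
  simp only [DD3, twist, Fin.isValue, Matrix.cons_val]
  linear_combination ((u ^ 16 + u ^ 3) * 2 * v 0 * v 1 * v 1 + (u ^ 3) * v 0 * v 0 * v 4 - (u ^ 3)
  * v 3 * v 5 * v 5 + (u ^ 3) * v 2 * v 3 * v 4) * hu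

lemma DD4_twist (v : Fin 6 → ℂ) {u : ℂ} (hu : u ^ 13 = 1) :
    DD4 (twist u v) = u ^ 4 * DD4 v := by
  simp only [DD4, twist, Fin.isValue, Matrix.cons_val]
  linear_combination (-(u ^ 17 + u ^ 4) * v 1 * v 1 * v 2 + (u ^ 4) * v 0 * v 5 * v 5 - (u ^ 4) *
  2 * v 3 * v 3 * v 5 - (u ^ 4) * v 0 * v 2 * v 4) * hu

lemma DD5_twist (v : Fin 6 → ℂ) {u : ℂ} (hu : u ^ 13 = 1) :
    DD5 (twist u v) = u ^ 5 * DD5 v := by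
  simp only [DD5, twist, Fin.isValue, Matrix.cons_val]
  linear_combination (-(u ^ 5) * v 3 * v 3 * v 3 + (u ^ 5) * v 2 * v 2 * v 4 - (u ^ 5) * 2 * v 2 *
  v 5 * v 5 + (u ^ 5) * v 1 * v 4 * v 5 + (u ^ 5) * 3 * v 0 * v 3 * v 5) * hu

lemma DD6_twist (v : Fin 6 → ℂ) {u : ℂ} (hu : u ^ 13 = 1) :
    DD6 (twist u v) = u ^ 6 * DD6 v := by
  simp only [DD6, twist, Fin.isValue, Matrix.cons_val]
  linear_combination ((u ^ 6) * v 0 * v 0 * v 5 - (u ^ 6) * 2 * v 0 * v 3 * v 3 + (u ^ 6) * v 2 *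
  v 3 * v 5 + (u ^ 6) * 3 * v 1 * v 3 * v 4) * hu

lemma DD7_twist (v : Fin 6 → ℂ) {u : ℂ} (hu : u ^ 13 = 1) :
    DD7 (twist u v) = u ^ 7 * DD7 v := by
  simp only [DD7, twist, Fin.isValue, Matrix.cons_val]
  linear_combination (-(u ^ 20 + u ^ 7) * v 1 * v 1 * v 1 + (u ^ 7) * v 2 * v 3 * v 3 - (u ^ 7) *
  v 0 * v 2 * v 5 - (u ^ 7) * 3 * v 0 * v 1 * v 4 + (u ^ 7) * 2 * v 0 * v 0 * v 3) * hu

lemma DD8_twist (v : Fin 6 → ℂ) {u : ℂ} (hu : u ^ 13 = 1) :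
    DD8 (twist u v) = u ^ 8 * DD8 v := by
  simp only [DD8, twist, Fin.isValue, Matrix.cons_val]
  linear_combination (-(u ^ 8) * v 0 * v 0 * v 0 + (u ^ 8) * v 1 * v 5 * v 5 - (u ^ 8) * v 1 * v 2
  * v 4 - (u ^ 8) * 3 * v 0 * v 2 * v 3 + (u ^ 8) * 2 * v 2 * v 2 * v 5) * hu

lemma DD9_twist (v : Fin 6 → ℂ) {u : ℂ} (hu : u ^ 13 = 1) :
    DD9 (twist u v) = u ^ 9 * DD9 v := by
  simp only [DD9, twist, Fin.isValue, Matrix.cons_val]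
  linear_combination ((u ^ 9) * 2 * v 0 * v 0 * v 2 + (u ^ 9) * v 2 * v 2 * v 3 + (u ^ 9) * v 1 *
  v 3 * v 5) * hu

lemma DD10_twist (v : Fin 6 → ℂ) {u : ℂ} (hu : u ^ 13 = 1) :
    DD10 (twist u v) = u ^ 10 * DD10 v := by
  simp only [DD10, twist, Fin.isValue, Matrix.cons_val]
  linear_combination (-(u ^ 10) * v 0 * v 2 * v 2 + (u ^ 10) * v 1 * v 3 * v 3 - (u ^ 10) * v 0 *
  v 1 * v 5) * hu

lemma DD11_twist (v : Fin 6 → ℂ) {u : ℂ} (hu : u ^ 13 = 1) :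
    DD11 (twist u v) = u ^ 11 * DD11 v := by
  simp only [DD11, twist, Fin.isValue, Matrix.cons_val]
  linear_combination (-(u ^ 11) * v 2 * v 2 * v 2 - (u ^ 11) * v 0 * v 1 * v 3 - (u ^ 11) * 3 * v
  1 * v 2 * v 5 + (u ^ 11) * 2 * v 1 * v 1 * v 4) * hu

lemma DD12_twist (v : Fin 6 → ℂ) {u : ℂ} (hu : u ^ 13 = 1) :
    DD12 (twist u v) = u ^ 12 * DD12 v := by
  simp only [DD12, twist, Fin.isValue, Matrix.cons_val]
  linear_combination (-(u ^ 12) * v 0 * v 0 * v 1 - (u ^ 12) * v 1 * v 2 * v 3) * hu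

lemma DDinf_twist (v : Fin 6 → ℂ) {u : ℂ} (hu : u ^ 13 = 1) :
    DDinf (twist u v) = DDinf v := by
  simp only [DDinf, twist, Fin.isValue, Matrix.cons_val]
  linear_combination ((1) * v 3 * v 4 * v 5) * hu

lemma GG0_twist (v : Fin 6 → ℂ) {u : ℂ} (hu : u ^ 13 = 1) :
    GG0 (twist u v) = GG0 v := by
  simp only [GG0, DD0_twist v hu, DDinf_twist v hu]

lemma GG1_twist (v : Fin 6 → ℂ) {u : ℂ} (hu : u ^ 13 = 1) :
    GG1 (twist u v) = u * GG1 v := by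
  simp only [GG1, DD0_twist v hu, DD1_twist v hu, DD2_twist v hu, DD3_twist v hu, DD4_twist v hu,
  DD5_twist v hu, DD7_twist v hu, DD9_twist v hu, DD10_twist v hu, DD11_twist v hu, DD12_twist v
  hu, DDinf_twist v hu]
  linear_combination (-(u) * DD7 v * DD7 v + (u) * 2 * DD2 v * DD12 v - (u) * 2 * DD3 v * DD11 v -
  (u) * 4 * DD4 v * DD10 v - (u) * 2 * DD9 v * DD5 v) * hu

lemma GG2_twist (v : Fin 6 → ℂ) {u : ℂ} (hu : u ^ 13 = 1) :
    GG2 (twist u v) = u ^ 2 * GG2 v := by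
  simp only [GG2, DD0_twist v hu, DD1_twist v hu, DD2_twist v hu, DD4_twist v hu, DD5_twist v hu,
  DD6_twist v hu, DD7_twist v hu, DD8_twist v hu, DD9_twist v hu, DD10_twist v hu, DD11_twist v
  hu, DDinf_twist v hu]
  linear_combination (-(u ^ 2) * 2 * DD4 v * DD11 v + (u ^ 2) * 2 * DD5 v * DD10 v - (u ^ 2) * 2 *
  DD6 v * DD9 v - (u ^ 2) * 2 * DD7 v * DD8 v) * hu

lemma GG3_twist (v : Fin 6 → ℂ) {u : ℂ} (hu : u ^ 13 = 1) :
    GG3 (twist u v) = u ^ 3 * GG3 v := by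
  simp only [GG3, DD0_twist v hu, DD1_twist v hu, DD2_twist v hu, DD3_twist v hu, DD4_twist v hu,
  DD6_twist v hu, DD7_twist v hu, DD8_twist v hu, DD9_twist v hu, DD10_twist v hu, DD12_twist v
  hu, DDinf_twist v hu]
  linear_combination (-(u ^ 3) * DD8 v * DD8 v + (u ^ 3) * 2 * DD6 v * DD10 v - (u ^ 3) * 2 * DD9
  v * DD7 v - (u ^ 3) * 4 * DD12 v * DD4 v) * hu

lemma GG4_twist (v : Fin 6 → ℂ) {u : ℂ} (hu : u ^ 13 = 1) :
    GG4 (twist u v) = u ^ 4 * GG4 v := by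
  simp only [GG4, DD0_twist v hu, DD1_twist v hu, DD2_twist v hu, DD3_twist v hu, DD4_twist v hu,
  DD5_twist v hu, DD7_twist v hu, DD8_twist v hu, DD9_twist v hu, DD10_twist v hu, DD12_twist v
  hu, DDinf_twist v hu]
  linear_combination ((u ^ 4) * 2 * DD5 v * DD12 v - (u ^ 4) * 2 * DD9 v * DD8 v - (u ^ 4) * 2 *
  DD10 v * DD7 v) * hu

lemma GG5_twist (v : Fin 6 → ℂ) {u : ℂ} (hu : u ^ 13 = 1) :
    GG5 (twist u v) = u ^ 5 * GG5 v := by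
  simp only [GG5, DD0_twist v hu, DD2_twist v hu, DD3_twist v hu, DD5_twist v hu, DD6_twist v hu,
  DD7_twist v hu, DD8_twist v hu, DD9_twist v hu, DD10_twist v hu, DD11_twist v hu, DD12_twist v
  hu, DDinf_twist v hu]
  linear_combination (-(u ^ 5) * 2 * DD9 v * DD9 v - (u ^ 5) * 2 * DD10 v * DD8 v + (u ^ 5) * 2 *
  DD6 v * DD12 v - (u ^ 5) * 2 * DD11 v * DD7 v) * hu

lemma GG6_twist (v : Fin 6 → ℂ) {u : ℂ} (hu : u ^ 13 = 1) :
    GG6 (twist u v) = u ^ 6 * GG6 v := by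
  simp only [GG6, DD0_twist v hu, DD1_twist v hu, DD2_twist v hu, DD3_twist v hu, DD4_twist v hu,
  DD5_twist v hu, DD6_twist v hu, DD7_twist v hu, DD8_twist v hu, DD11_twist v hu, DD12_twist v
  hu, DDinf_twist v hu]
  linear_combination (-(u ^ 6) * 2 * DD12 v * DD7 v - (u ^ 6) * 2 * DD8 v * DD11 v) * hu

lemma GG7_twist (v : Fin 6 → ℂ) {u : ℂ} (hu : u ^ 13 = 1) :
    GG7 (twist u v) = u ^ 7 * GG7 v := by
  simp only [GG7, DD0_twist v hu, DD1_twist v hu, DD2_twist v hu, DD5_twist v hu, DD6_twist v hu,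
  DD7_twist v hu, DD8_twist v hu, DD9_twist v hu, DD10_twist v hu, DD11_twist v hu, DD12_twist v
  hu, DDinf_twist v hu]
  linear_combination (-(u ^ 7) * 2 * DD10 v * DD10 v - (u ^ 7) * 2 * DD8 v * DD12 v - (u ^ 7) * 2
  * DD9 v * DD11 v) * hu

lemma GG8_twist (v : Fin 6 → ℂ) {u : ℂ} (hu : u ^ 13 = 1) :
    GG8 (twist u v) = u ^ 8 * GG8 v := by
  simp only [GG8, DD0_twist v hu, DD1_twist v hu, DD2_twist v hu, DD3_twist v hu, DD4_twist v hu,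
  DD5_twist v hu, DD6_twist v hu, DD7_twist v hu, DD8_twist v hu, DD10_twist v hu, DD11_twist v
  hu, DDinf_twist v hu]
  linear_combination (-(u ^ 8) * 2 * DD11 v * DD10 v) * hu

lemma GG9_twist (v : Fin 6 → ℂ) {u : ℂ} (hu : u ^ 13 = 1) :
    GG9 (twist u v) = u ^ 9 * GG9 v := by
  simp only [GG9, DD0_twist v hu, DD1_twist v hu, DD3_twist v hu, DD4_twist v hu, DD5_twist v hu,
  DD6_twist v hu, DD8_twist v hu, DD9_twist v hu, DD10_twist v hu, DD11_twist v hu, DD12_twist v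
  hu, DDinf_twist v hu]
  linear_combination (-(u ^ 9) * DD11 v * DD11 v - (u ^ 9) * 4 * DD10 v * DD12 v) * hu

lemma GG10_twist (v : Fin 6 → ℂ) {u : ℂ} (hu : u ^ 13 = 1) :
    GG10 (twist u v) = u ^ 10 * GG10 v := by
  simp only [GG10, DD0_twist v hu, DD1_twist v hu, DD3_twist v hu, DD4_twist v hu, DD5_twist v hu,
  DD6_twist v hu, DD7_twist v hu, DD9_twist v hu, DD10_twist v hu, DD11_twist v hu, DD12_twist v
  hu, DDinf_twist v hu]
  linear_combination (-(u ^ 10) * 2 * DD12 v * DD11 v) * hu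

lemma GG11_twist (v : Fin 6 → ℂ) {u : ℂ} (hu : u ^ 13 = 1) :
    GG11 (twist u v) = u ^ 11 * GG11 v := by
  simp only [GG11, DD0_twist v hu, DD2_twist v hu, DD3_twist v hu, DD4_twist v hu, DD5_twist v hu,
  DD6_twist v hu, DD7_twist v hu, DD8_twist v hu, DD9_twist v hu, DD11_twist v hu, DD12_twist v
  hu, DDinf_twist v hu]
  linear_combination (-(u ^ 11) * 2 * DD12 v * DD12 v) * hu

lemma GG12_twist (v : Fin 6 → ℂ) {u : ℂ} (hu : u ^ 13 = 1) :
    GG12 (twist u v) = u ^ 12 * GG12 v := by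
  simp only [GG12, DD0_twist v hu, DD1_twist v hu, DD2_twist v hu, DD3_twist v hu, DD4_twist v hu,
  DD6_twist v hu, DD8_twist v hu, DD9_twist v hu, DD10_twist v hu, DD11_twist v hu, DD12_twist v
  hu, DDinf_twist v hu]
  ring

lemma wF_twist (v : Fin 6 → ℂ) {u : ℂ} (hu : u ^ 13 = 1) (ν : ℕ) (h : u = ζ ^ ν) :
    wF 0 (twist u v) = wF ν v := by
  simp only [wF, AA0_twist v hu, AA1_twist v hu, AA2_twist v hu, AA3_twist v hu, AA4_twist v hu,
    AA5_twist v hu, AA6_twist v hu, mul_comm _ ν, pow_mul, ← h, pow_zero]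
  ring

lemma dF_twist (v : Fin 6 → ℂ) {u : ℂ} (hu : u ^ 13 = 1) (ν : ℕ) (h : u = ζ ^ ν) :
    dF 0 (twist u v) = dF ν v := by
  simp only [dF, GG0_twist v hu, GG1_twist v hu, GG2_twist v hu, GG3_twist v hu, GG4_twist v hu,
    GG5_twist v hu, GG6_twist v hu, GG7_twist v hu, GG8_twist v hu, GG9_twist v hu,
    GG10_twist v hu, GG11_twist v hu, GG12_twist v hu, mul_comm _ ν, pow_mul, ← h,
    pow_zero]
  ring

lemma psi_natCast (n : ℕ) : ψ (n : ZMod 13) = ζ ^ n := by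
  have := ZMod.stdAddChar_coe (N := 13) (n : ℤ)
  rw [Int.cast_natCast] at this
  rw [this, ζ, ← Complex.exp_nat_mul]
  congr 1
  push_cast
  ring

lemma zeta_pow_thirteen : ζ ^ 13 = 1 := by
  rw [← psi_natCast, show ((13 : ℕ) : ZMod 13) = 0 by decide, AddChar.map_zero_eq_one]

lemma toVec_weilT (ν : ℕ) (f : ZMod 13 → ℂ) :
    toVec (weilT ν f) = twist (ζ ^ ν) (toVec f) := by
  have h (n : ℕ) : ψ ((n * ν : ℕ) : ZMod 13) = (ζ ^ ν) ^ n := by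
    rw [psi_natCast, ← pow_mul, mul_comm]
  have hk (k : ZMod 13) (n : ℕ) (hn : 5 * k ^ 2 = n) :
      weilT ν f k = (ζ ^ ν) ^ n * f k := by
    rw [weilT, ← h]
    congr 2
    push_cast
    rw [← hn]
    ring
  simp only [toVec, twist, Fin.isValue, Matrix.cons_val, hk 2 7 (by decide), hk 6 11 (by decide),
    hk 5 8 (by decide), hk 3 6 (by decide), hk 9 2 (by decide), hk 1 5 (by decide)]

lemma toVec_smul (c : ℂ) (f : ZMod 13 → ℂ) : toVec (c • f) = c • toVec f := by
  ext i
  fin_cases i <;> simp [toVec]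

/-- The quartic form whose conjugates are the `wF ν`. -/
def quarticF (f : ZMod 13 → ℂ) : ℂ := AA0 (toVec f) ^ 2 / 13

/-- The sextic form whose conjugates are the `dF ν`. -/
def sexticF (f : ZMod 13 → ℂ) : ℂ := GG0 (toVec f) / 13

lemma quarticF_smul (c : ℂ) (f : ZMod 13 → ℂ) : quarticF (c • f) = c ^ (2 * 2) * quarticF f := by
  simp only [quarticF, toVec_smul, AA0, Pi.smul_apply, smul_eq_mul]
  ring

lemma sexticF_smul (c : ℂ) (f : ZMod 13 → ℂ) : sexticF (c • f) = c ^ (2 * 3) * sexticF f := by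
  simp only [sexticF, toVec_smul, GG0, DD0, DDinf, Pi.smul_apply, smul_eq_mul]
  ring

lemma zeta_pow_pow_thirteen (ν : ℕ) : (ζ ^ ν) ^ 13 = 1 := by
  rw [← pow_mul, mul_comm, pow_mul, zeta_pow_thirteen, one_pow]

lemma toVec_weilT' (a : ZMod 13) (f : ZMod 13 → ℂ) :
    toVec (weilT a f) = twist (ζ ^ a.val) (toVec f) := by
  rw [← toVec_weilT, ZMod.natCast_zmod_val]

lemma quarticF_weilT (a : ZMod 13) (f : ZMod 13 → ℂ) : quarticF (weilT a f) = quarticF f := by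
  rw [quarticF, quarticF, toVec_weilT', AA0_twist _ (zeta_pow_pow_thirteen _)]

lemma sexticF_weilT (a : ZMod 13) (f : ZMod 13 → ℂ) : sexticF (weilT a f) = sexticF f := by
  rw [sexticF, sexticF, toVec_weilT', GG0_twist _ (zeta_pow_pow_thirteen _)]

lemma toVec_dil_two {f : ZMod 13 → ℂ} (hf : f.Odd) :
    toVec (dil 2 f) = ![-f 9, -f 1, -f 3, f 6, f 5, f 2] := by
  rw [← hf 9, ← hf 1, ← hf 3]
  rfl

lemma invariant_dil_of_two {F : (ZMod 13 → ℂ) → ℂ} (h : ∀ f, Function.Odd f → F (dil 2 f) = F f)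
    (a : ZMod 13) (f : ZMod 13 → ℂ) (ha : a ≠ 0) (hf : f.Odd) : F (dil a f) = F f := by
  obtain ⟨n, rfl⟩ : ∃ n : Fin 13, a = 2 ^ (n : ℕ) := by
    revert a
    decide
  generalize (n : ℕ) = m
  induction m with
  | zero => exact congrArg F (by funext k; simp [dil])
  | succ m ih =>
    rw [show dil (2 ^ (m + 1)) f = dil 2 (dil (2 ^ m) f) by
      funext k; simp only [dil]; ring_nf]
    rw [h _ (hf.dil _)]
    exact ih

lemma quarticF_dil (a : ZMod 13) (f : ZMod 13 → ℂ) (ha : a ≠ 0) (hf : f.Odd) :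
    quarticF (dil a f) = quarticF f := by
  refine invariant_dil_of_two (fun g hg => ?_) a f ha hf
  rw [quarticF, toVec_dil_two hg]
  simp only [quarticF, AA0, toVec, Fin.isValue, Matrix.cons_val]
  ring

lemma sexticF_dil (a : ZMod 13) (f : ZMod 13 → ℂ) (ha : a ≠ 0) (hf : f.Odd) :
    sexticF (dil a f) = sexticF f := by
  refine invariant_dil_of_two (fun g hg => ?_) a f ha hf
  rw [sexticF, toVec_dil_two hg]
  simp only [sexticF, GG0, DD0, DDinf, toVec, Fin.isValue, Matrix.cons_val]
  ring

lemma sum_range_thirteen (g : ZMod 13 → ℂ) : ∑ ν ∈ Finset.range 13, g ν = ∑ ν, g ν := by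
  rw [Finset.sum_range]
  exact Fintype.sum_equiv (Equiv.refl (ZMod 13)) _ _ fun ν => congrArg g (ZMod.natCast_zmod_val ν)

lemma powSum_quarticF {f : ZMod 13 → ℂ} (hf : f.Odd) (k : ℕ) :
    powSum quarticF 2 k f
      = ∑ ν ∈ Finset.range 13, wF ν (toVec f) ^ k + wInf (toVec f) ^ k := by
  rw [powSum, ← sum_range_thirteen fun ν => quarticF (weilS (weilT ν f)) ^ k]
  refine congrArg₂ (· + ·) (Finset.sum_congr rfl fun ν _ => ?_) ?_
  · rw [quarticF, AA0_weilS_sq (hf.weilT _), toVec_weilT,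
      wF_twist _ (zeta_pow_pow_thirteen ν) ν rfl, mul_div_cancel_left₀ _ (by norm_num)]
  · rw [quarticF, wInf]
    ring

lemma powSum_sexticF {f : ZMod 13 → ℂ} (hf : f.Odd) (k : ℕ) :
    powSum sexticF 3 k f
      = ∑ ν ∈ Finset.range 13, dF ν (toVec f) ^ k + dInf (toVec f) ^ k := by
  rw [powSum, ← sum_range_thirteen fun ν => sexticF (weilS (weilT ν f)) ^ k]
  refine congrArg₂ (· + ·) (Finset.sum_congr rfl fun ν _ => ?_) ?_
  · rw [sexticF, GG0_weilS (hf.weilT _), toVec_weilT,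
      dF_twist _ (zeta_pow_pow_thirteen ν) ν rfl, mul_div_cancel_left₀ _ (by norm_num)]
  · rw [sexticF, dInf]
    ring

/-! ### The theta vector and its modular transformations -/

/-- The general term of the odd theta series. -/
def thTerm (m : ℤ) (z : ℂ) : ℂ :=
  (-1) ^ (m + 1) * cexp (Real.pi * I * z * (2 * m - 1) ^ 2 / 52)

/-- The theta series over the residue class `2 m - 1 = j` in `ZMod 13`. -/
def thClass (j : ZMod 13) (z : ℂ) : ℂ :=
  ∑' m : ℤ, if ((2 * m - 1 : ℤ) : ZMod 13) = j then thTerm m z else 0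

/-- The eta-multiplied vector of theta series, as a function on `ZMod 13`. -/
def thVec (z : ℂ) (j : ZMod 13) : ℂ := ModularForm.eta z * thClass j z

lemma neg_one_zpow_eq_cexp (m : ℤ) : (-1 : ℂ) ^ m = cexp (Real.pi * I * m) := by
  rw [← exp_pi_mul_I, ← exp_int_mul]
  ring_nf

lemma thTerm_eq (m : ℤ) (z : ℂ) :
    thTerm m z = -cexp (Real.pi * I * z / 52) *
      jacobiTheta₂_term m (1 / 2 - z / 26) (z / 13) := by
  rw [thTerm, zpow_add₀ (by norm_num), neg_one_zpow_eq_cexp, jacobiTheta₂_term, zpow_one,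
    mul_neg_one, neg_mul, neg_mul, ← Complex.exp_add, ← Complex.exp_add]
  ring_nf

lemma im_div_thirteen {z : ℂ} (hz : 0 < z.im) : 0 < (z / 13).im := by
  have : (z / 13).im = z.im / 13 := by
    simp
  rw [this]; positivity

lemma summable_thTerm {z : ℂ} (hz : 0 < z.im) : Summable fun m : ℤ => thTerm m z := by
  simp only [thTerm_eq]
  exact (hasSum_jacobiTheta₂_term _ (im_div_thirteen hz)).summable.mul_left _

lemma summable_thTerm_ite {z : ℂ} (hz : 0 < z.im) (j : ZMod 13) :
    Summable fun m : ℤ => if ((2 * m - 1 : ℤ) : ZMod 13) = j then thTerm m z else 0 := by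
  refine ((summable_thTerm hz).indicator {m : ℤ | ((2 * m - 1 : ℤ) : ZMod 13) = j}).congr
    fun m => ?_
  by_cases h : ((2 * m - 1 : ℤ) : ZMod 13) = j
  · rw [if_pos h, Set.indicator_of_mem (Set.mem_ofPred_eq ▸ h)]
  · rw [if_neg h, Set.indicator_of_notMem (Set.mem_ofPred_eq ▸ h)]

lemma thClass_odd (z : ℂ) : Function.Odd fun j => thClass j z := by
  intro j
  simp only [thClass, ← tsum_neg]
  refine (Equiv.subLeft (1 : ℤ)).tsum_eq _ |>.symm.trans (tsum_congr fun m => ?_)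
  have h : ((2 * (1 - m) - 1 : ℤ) : ZMod 13) = -((2 * m - 1 : ℤ) : ZMod 13) := by
    push_cast; ring
  simp only [Equiv.subLeft_apply, h, neg_inj]
  split_ifs with hj
  · simp only [thTerm]
    have : (-1 : ℂ) ^ (1 - m + 1) = -(-1) ^ (m + 1) := by
      rw [show 1 - m + 1 = -(m + 1) + 3 by ring, zpow_add₀ (by norm_num), zpow_neg,
        ← inv_zpow, show (-1 : ℂ)⁻¹ = -1 by norm_num]
      norm_num [zpow_ofNat]
    rw [this]; push_cast; ring_nf
  · simp

lemma thVec_odd (z : ℂ) : (thVec z).Odd := fun j => by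
  simp only [thVec, thClass_odd z j, mul_neg]

lemma thClass_eq_tsum (r : ℤ) (z : ℂ) :
    thClass ((2 * r - 1 : ℤ) : ZMod 13) z = ∑' n : ℤ, thTerm (13 * n + r) z := by
  have hinj : Function.Injective fun n : ℤ => 13 * n + r := fun a b h => by
    simp only at h; omega
  rw [thClass, ← hinj.tsum_eq]
  · refine tsum_congr fun n => if_pos ?_
    push_cast
    rw [show (13 : ZMod 13) = 0 from rfl]; ring
  · intro m hm
    simp only [Function.mem_support, ne_eq, ite_eq_right_iff, not_forall] at hm
    obtain ⟨h, -⟩ := hm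
    rw [ZMod.intCast_eq_intCast_iff_dvd_sub] at h
    exact ⟨(m - r) / 13, by simp only; omega⟩

lemma thClass_eq_theta (r : ℤ) (z : ℂ) :
    thClass ((2 * r - 1 : ℤ) : ZMod 13) z = (-1) ^ (r + 1) *
      cexp (Real.pi * I * z * (2 * r - 1) ^ 2 / 52) *
        jacobiTheta₂ (1 / 2 + (2 * r - 1) * z / 2) (13 * z) := by
  rw [thClass_eq_tsum, jacobiTheta₂, ← tsum_mul_left]
  refine tsum_congr fun n => ?_
  have : (-1 : ℂ) ^ (13 * n + r + 1) = (-1) ^ (r + 1) * (-1) ^ n := by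
    rw [← zpow_add₀ (by norm_num), show 13 * n + r + 1 = r + 1 + n + 2 * (6 * n) by ring,
      zpow_add₀ (by norm_num), zpow_mul _ 2]
    norm_num
  rw [thTerm, this, neg_one_zpow_eq_cexp n, jacobiTheta₂_term,
    mul_assoc ((-1) ^ (r + 1)) (cexp _) (cexp _), mul_assoc ((-1) ^ (r + 1)) (cexp _) (cexp _),
    ← Complex.exp_add, ← Complex.exp_add]
  push_cast
  ring_nf

lemma psi_intCast (n : ℤ) : ψ (n : ZMod 13) = cexp (2 * Real.pi * I * n / 13) := by
  rw [ψ, ZMod.stdAddChar_coe]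
  norm_num

lemma weilS_thClass (l : ℤ) {z : ℂ} (hz : 0 < z.im) :
    weilS (fun j => thClass j z) (l : ZMod 13) =
      -cexp (Real.pi * I * z / 52 - 20 * Real.pi * I * l / 13) *
        jacobiTheta₂ (1 / 2 - z / 26 + 20 * l / 13) (z / 13) := by
  simp only [weilS, thClass, ← tsum_mul_left]
  rw [← Summable.tsum_finsetSum fun j _ => (summable_thTerm_ite hz j).mul_left _, jacobiTheta₂,
    ← tsum_mul_left]
  refine tsum_congr fun m => ?_
  simp only [mul_ite, mul_zero, Finset.sum_ite_eq, Finset.mem_univ, if_true]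
  rw [show (10 * (l : ZMod 13) * ((2 * m - 1 : ℤ) : ZMod 13)) =
    ((10 * l * (2 * m - 1) : ℤ) : ZMod 13) by push_cast; ring, psi_intCast, thTerm_eq,
    jacobiTheta₂_term, jacobiTheta₂_term, neg_mul, neg_mul, mul_neg, ← Complex.exp_add,
    ← Complex.exp_add, ← Complex.exp_add]
  push_cast
  ring_nf

lemma jacobiTheta₂_add_int (x τ : ℂ) (n : ℤ) : jacobiTheta₂ (x + n) τ = jacobiTheta₂ x τ := by
  have h : Function.Periodic (fun x => jacobiTheta₂ x τ) 1 := fun x => jacobiTheta₂_add_left x τ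
  simpa using h.int_mul n x

lemma thClass_neg_inv (r : ℤ) {z : ℂ} (hz : 0 < z.im) :
    thClass ((2 * r - 1 : ℤ) : ZMod 13) (-1 / z) = I * (-I * (z / 13)) ^ (1 / 2 : ℂ) *
      weilS (fun j => thClass j z) ((2 * r - 1 : ℤ) : ZMod 13) := by
  have hz0 : z ≠ 0 := by rintro rfl; simp at hz
  have hw : (-I * (z / 13)) ^ (1 / 2 : ℂ) ≠ 0 := by
    rw [Ne, cpow_eq_zero_iff]
    simp [hz0]
  rw [thClass_eq_theta, weilS_thClass _ hz]
  have hθ : jacobiTheta₂ (1 / 2 + (2 * r - 1) * (-1 / z) / 2) (13 * (-1 / z)) =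
      (-I * (z / 13)) ^ (1 / 2 : ℂ) * cexp (Real.pi * I * (z - (2 * r - 1)) ^ 2 / (52 * z)) *
        jacobiTheta₂ (((2 * r - 1) - z) / 26) (z / 13) := by
    rw [← jacobiTheta₂_neg_left (((2 * r - 1) - z) / 26), jacobiTheta₂_functional_equation
      (-(((2 * r - 1) - z) / 26)) (z / 13)]
    rw [show -((2 * (r : ℂ) - 1 - z) / 26) / (z / 13) = 1 / 2 + (2 * r - 1) * (-1 / z) / 2 by
      field_simp; ring, show -1 / (z / 13) = 13 * (-1 / z) by field_simp]
    have he : cexp (Real.pi * I * (z - (2 * r - 1)) ^ 2 / (52 * z)) *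
        cexp (-Real.pi * I * (-((2 * (r : ℂ) - 1 - z) / 26)) ^ 2 / (z / 13)) = 1 := by
      rw [← Complex.exp_add, ← Complex.exp_zero]
      congr 1
      field_simp
      ring
    rw [one_div ((-I * (z / 13)) ^ (1 / 2 : ℂ))]
    linear_combination
      (-jacobiTheta₂ (1 / 2 + (2 * r - 1) * (-1 / z) / 2) (13 * (-1 / z))) * he -
      cexp (Real.pi * I * (z - (2 * r - 1)) ^ 2 / (52 * z)) *
        cexp (-Real.pi * I * (-((2 * (r : ℂ) - 1 - z) / 26)) ^ 2 / (z / 13)) *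
        jacobiTheta₂ (1 / 2 + (2 * r - 1) * (-1 / z) / 2) (13 * (-1 / z)) * mul_inv_cancel₀ hw
  have hper : jacobiTheta₂ (1 / 2 - z / 26 + 20 * ((2 * r - 1 : ℤ) : ℂ) / 13) (z / 13) =
      jacobiTheta₂ (((2 * r - 1) - z) / 26) (z / 13) := by
    rw [← jacobiTheta₂_add_int (((2 * r - 1) - z) / 26) _ (3 * r - 1)]
    congr 1
    push_cast
    ring
  rw [hθ, hper, neg_one_zpow_eq_cexp]
  have he : cexp (Real.pi * I * ((r + 1 : ℤ) : ℂ)) *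
      cexp (Real.pi * I * (-1 / z) * (2 * r - 1) ^ 2 / 52) *
      cexp (Real.pi * I * (z - (2 * r - 1)) ^ 2 / (52 * z)) =
      -I * cexp (Real.pi * I * z / 52 - 20 * Real.pi * I * ((2 * r - 1 : ℤ) : ℂ) / 13) := by
    have hI : -I = cexp (-(Real.pi / 2 * I)) := by
      rw [Complex.exp_neg, exp_pi_div_two_mul_I, inv_I]
    rw [hI, ← Complex.exp_add, ← Complex.exp_add, ← Complex.exp_add, Complex.exp_eq_exp_iff_exists_int]
    refine ⟨2 * r, ?_⟩
    push_cast
    field_simp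
    ring
  linear_combination (-I * (z / 13)) ^ (1 / 2 : ℂ) *
    jacobiTheta₂ (((2 * r - 1) - z) / 26) (z / 13) * he

lemma thClass_add_one (j : ZMod 13) (z : ℂ) :
    thClass j (z + 1) = cexp (-(3 * Real.pi * I / 4)) * weilT 1 (fun j => thClass j z) j := by
  simp only [thClass, weilT, ← tsum_mul_left]
  refine tsum_congr fun m => ?_
  split_ifs with h
  · obtain ⟨t, ht⟩ : ∃ t, m * (m - 1) = t + t := Int.even_mul_pred_self m
    have h2 : (5 * 1 * j ^ 2 : ZMod 13) = ((5 + t : ℤ) : ZMod 13) := by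
      have : (m : ZMod 13) * (m - 1) = t + t := by exact_mod_cast congrArg (Int.cast (R := ZMod 13)) ht
      have h26 : (26 : ZMod 13) = 0 := rfl
      have h39 : (39 : ZMod 13) = 0 := rfl
      rw [← h]; push_cast
      linear_combination 20 * this + t * h39
    rw [h2, psi_intCast, thTerm, thTerm]
    have h3 : (m : ℂ) * (m - 1) = t + t := by exact_mod_cast congrArg (Int.cast (R := ℂ)) ht
    have he : cexp (Real.pi * I * (z + 1) * (2 * m - 1) ^ 2 / 52) =
        cexp (-(3 * Real.pi * I / 4)) * (cexp (2 * Real.pi * I * ((5 + t : ℤ) : ℂ) / 13) *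
          cexp (Real.pi * I * z * (2 * m - 1) ^ 2 / 52)) := by
      rw [← Complex.exp_add, ← Complex.exp_add]
      congr 1
      push_cast
      linear_combination (Real.pi * I / 13) * h3
    rw [he]; ring
  · simp

lemma eta_add_one (z : ℂ) :
    ModularForm.eta (z + 1) = cexp (Real.pi * I / 12) * ModularForm.eta z := by
  have h (n : ℕ) : ModularForm.eta_q n (z + 1) = ModularForm.eta_q n z := by
    rw [ModularForm.eta_q_eq_pow, ModularForm.eta_q_eq_pow, mul_add, Complex.exp_add, mul_one,
      exp_two_pi_mul_I, mul_one]
  simp only [ModularForm.eta, h, Function.Periodic.qParam]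
  rw [← mul_assoc, ← Complex.exp_add]
  congr 2
  push_cast
  ring

lemma thVec_add_one (z : ℂ) :
    thVec (z + 1) = cexp (-(2 * Real.pi * I / 3)) • weilT 1 (thVec z) := by
  funext j
  have h : cexp (-(2 * Real.pi * I / 3)) = cexp (Real.pi * I / 12) * cexp (-(3 * Real.pi * I / 4)) := by
    rw [← Complex.exp_add]; ring_nf
  simp only [thVec, eta_add_one, thClass_add_one, Pi.smul_apply, smul_eq_mul, weilT, h]
  ring

lemma exists_eta_neg_inv {z : ℂ} (hz : 0 < z.im) :
    ∃ s : ℂ, s ^ 2 = -I * z ∧ ModularForm.eta (-1 / z) = s * ModularForm.eta z := by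
  have hz0 : z ≠ 0 := by rintro rfl; simp at hz
  refine ⟨(sqrt I)⁻¹ * sqrt z, ?_, ?_⟩
  · have h (w : ℂ) : sqrt w ^ 2 = w := by rw [sqrt, ← cpow_nat_mul]; norm_num
    rw [mul_pow, inv_pow, h, h, inv_I]
  · simpa [mul_assoc] using ModularForm.eta_comp_eq_csqrt_I_inv hz

lemma exists_thVec_neg_inv {z : ℂ} (hz : 0 < z.im) :
    ∃ c : ℂ, c ^ 2 = z ^ 2 / 13 ∧ thVec (-1 / z) = c • weilS (thVec z) := by
  obtain ⟨s, hs, hη⟩ := exists_eta_neg_inv hz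
  refine ⟨s * (I * (-I * (z / 13)) ^ (1 / 2 : ℂ)), ?_, ?_⟩
  · have : ((-I * (z / 13)) ^ (1 / 2 : ℂ)) ^ 2 = -I * (z / 13) := by
      rw [← cpow_nat_mul]; norm_num
    rw [mul_pow, mul_pow, hs, this]
    linear_combination (I ^ 2 - 1) * z ^ 2 / 13 * I_sq
  · funext k
    obtain ⟨r, rfl⟩ : ∃ r : ℤ, ((2 * r - 1 : ℤ) : ZMod 13) = k := by
      refine ⟨(7 * (k + 1)).val, ?_⟩
      revert k; decide
    have hw : weilS (thVec z) = ModularForm.eta z • weilS fun j => thClass j z := by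
      rw [← weilS_smul]; rfl
    rw [thVec, hη, thClass_neg_inv r hz, hw]
    simp only [Pi.smul_apply, smul_eq_mul]
    ring

section PowSum

variable {F : (ZMod 13 → ℂ) → ℂ} {e : ℕ}

lemma powSum_thVec_add_one (hsmul : ∀ (c : ℂ) f, F (c • f) = c ^ (2 * e) * F f)
    (hT : ∀ a f, F (weilT a f) = F f) (k : ℕ) (z : ℂ) :
    powSum F e k (thVec (z + 1)) =
      cexp (-(2 * Real.pi * I / 3)) ^ (2 * e * k) * powSum F e k (thVec z) := by
  rw [thVec_add_one, powSum_smul hsmul, powSum_weilT e (fun a f _ => hT a f) k 1 (thVec_odd z)]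

lemma powSum_thVec_neg_inv (hsmul : ∀ (c : ℂ) f, F (c • f) = c ^ (2 * e) * F f)
    (hT : ∀ a f, F (weilT a f) = F f)
    (hdil : ∀ a f, a ≠ 0 → Function.Odd f → F (dil a f) = F f) (k : ℕ) {z : ℂ} (hz : 0 < z.im) :
    powSum F e k (thVec (-1 / z)) = z ^ (2 * e * k) * powSum F e k (thVec z) := by
  obtain ⟨c, hc, h⟩ := exists_thVec_neg_inv hz
  rw [h, powSum_smul hsmul, powSum_weilS hsmul (fun a f _ => hT a f) hdil k (thVec_odd z),
    mul_assoc 2, pow_mul c, hc, div_pow, ← pow_mul]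
  field_simp

end PowSum

lemma etaF_eq_eta (z : ℂ) : etaF z = ModularForm.eta z := by
  simp only [etaF, ModularForm.eta, ModularForm.eta_q_eq_pow, Function.Periodic.qParam]
  norm_num

lemma th13_eq (l : ℤ) (z : ℂ) (c : ℚ) (hc : c = l ^ 2 / 104) (r : ℤ) (hr : l = 2 * r - 1) :
    th13 c l z = (-1) ^ (r + 1) * thClass ((l : ℤ) : ZMod 13) z := by
  subst hc hr
  rw [thClass_eq_tsum, th13, ← tsum_mul_left, ← tsum_mul_left]
  refine tsum_congr fun n => ?_
  have : (-1 : ℂ) ^ (13 * n + r + 1) * (-1) ^ (r + 1) = (-1) ^ n := by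
    rw [← zpow_add₀ (by norm_num), show 13 * n + r + 1 + (r + 1) = n + 2 * (6 * n + r + 1) by ring,
      zpow_add₀ (by norm_num), zpow_mul _ 2]
    norm_num
  rw [thTerm, ← mul_assoc ((-1 : ℂ) ^ (r + 1)), mul_comm ((-1 : ℂ) ^ (r + 1)), this, mul_left_comm,
    ← Complex.exp_add]
  push_cast
  ring_nf

lemma xV_eq_toVec (z : ℂ) : xV z = toVec (thVec z) := by
  funext i
  have h (l r : ℤ) (c : ℚ) (hc : c = l ^ 2 / 104) (hr : l = 2 * r - 1) := th13_eq l z c hc r hr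
  have hneg (j : ZMod 13) := thClass_odd z j
  fin_cases i <;> simp only [xV, ta, toVec, thVec, etaF_eq_eta, Fin.zero_eta, Fin.mk_one,
    Fin.reduceFinMk, Matrix.cons_val, mul_neg]
  · rw [h 11 6 _ (by norm_num) (by norm_num), show ((11 : ℤ) : ZMod 13) = -2 from rfl]
    simp only [hneg 2]
    norm_num [zpow_ofNat]
  · rw [h 7 4 _ (by norm_num) (by norm_num), show ((7 : ℤ) : ZMod 13) = -6 from rfl]
    simp only [hneg 6]
    norm_num [zpow_ofNat]
  · rw [h 5 3 _ (by norm_num) (by norm_num)]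
    norm_num [zpow_ofNat]
  · rw [h 3 2 _ (by norm_num) (by norm_num)]
    norm_num [zpow_ofNat]
  · rw [h 9 5 _ (by norm_num) (by norm_num)]
    norm_num [zpow_ofNat]
  · rw [h 1 1 _ (by norm_num) (by norm_num)]
    norm_num [zpow_ofNat]

/-! ### Level one modular forms -/

section LevelOne

open UpperHalfPlane hiding I
open ModularForm hiding eta
open ModularFormClass SlashInvariantForm MatrixGroups Filter Topology ModularGroup

lemma exists_levelOne_modularForm {k : ℤ} {G : ℂ → ℂ} {L : ℂ}
    (hol : DifferentiableOn ℂ G {z | 0 < z.im})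
    (hT : ∀ z : ℂ, 0 < z.im → G (z + 1) = G z)
    (hS : ∀ z : ℂ, 0 < z.im → G (-1 / z) = z ^ k * G z)
    (hL : Tendsto (fun z : ℍ => G z) atImInfty (𝓝 L)) :
    ∃ M : ModularForm 𝒮ℒ k, (qExpansion 1 M).coeff 0 = L ∧ ∀ z : ℍ, M z = G z := by
  have hT' : (fun z : ℍ => G z) ∣[k] T = fun z : ℍ => G z := by
    ext z
    rw [SL_slash_apply, modular_T_smul]
    simpa [denom, coe_T, add_comm] using hT z z.2
  have hS' : (fun z : ℍ => G z) ∣[k] S = fun z : ℍ => G z := by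
    ext z
    rw [SL_slash_apply, UpperHalfPlane.modular_S_smul]
    have hz : (z : ℂ) ^ k ≠ 0 := zpow_ne_zero _ z.ne_zero
    have := hS z z.2
    rw [neg_div, one_div, ← inv_neg] at this
    simp only [this, denom]
    simp
    field_simp
  let M : ModularForm 𝒮ℒ k :=
    { toFun := fun z => G z
      slash_action_eq' := by
        rintro A ⟨A, rfl⟩
        exact slash_action_generators_SL2Z hS' hT' A
      holo' := by
        rw [UpperHalfPlane.mdifferentiable_iff]
        refine hol.congr fun z hz => ?_
        simp [ofComplex_apply_of_im_pos hz]
      bdd_at_cusps' := fun hc => by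
        rw [Subgroup.IsArithmetic.isCusp_iff_isCusp_SL2Z] at hc
        rw [OnePoint.isBoundedAt_iff_forall_SL2Z hc]
        intro γ _
        rw [slash_action_generators_SL2Z hS' hT']
        exact hL.isBigO_one ℝ }
  refine ⟨M, ?_, fun z => rfl⟩
  rw [qExpansion_coeff_zero one_pos
    (ModularFormClass.analyticAt_cuspFunction_zero _ one_pos one_mem_strictPeriods_SL)
    (SlashInvariantFormClass.periodic_comp_ofComplex _ one_mem_strictPeriods_SL)]
  exact hL.limUnder_eq

lemma levelOne_eq_of_coeff_zero_eq {k : ℤ} (hk : k < 12) {M N : ModularForm 𝒮ℒ k}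
    (h : (qExpansion 1 M).coeff 0 = (qExpansion 1 N).coeff 0) : M = N := by
  have h0 : (qExpansion 1 (M - N)).coeff 0 = 0 := by
    rw [ModularForm.qExpansion_sub one_pos one_mem_strictPeriods_SL]
    rw [map_sub, h, sub_self]
  have := rank_zero_iff_forall_zero.mp (CuspForm.rank_eq_zero_of_weight_lt_twelve hk)
    (toCuspForm (M - N) h0)
  ext z
  have hz := DFunLike.congr_fun this z
  rw [toCuspForm_apply] at hz
  simpa [sub_eq_zero] using hz

lemma thClass_differentiableAt (j : ZMod 13) {z : ℂ} (hz : 0 < z.im) :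
    DifferentiableAt ℂ (thClass j) z := by
  obtain ⟨r, rfl⟩ : ∃ r : ℤ, ((2 * r - 1 : ℤ) : ZMod 13) = j := by
    refine ⟨(7 * (j + 1)).val, ?_⟩
    revert j; decide
  rw [funext (thClass_eq_theta r)]
  have hz' : 0 < ((1 / 2 + (2 * r - 1) * z / 2, 13 * z) : ℂ × ℂ).2.im := by simpa using hz
  have h := (hasFDerivAt_jacobiTheta₂ (1 / 2 + (2 * r - 1) * z / 2) hz').differentiableAt
  have h2 : DifferentiableAt ℂ (fun z : ℂ => ((1 / 2 + (2 * r - 1) * z / 2, 13 * z) : ℂ × ℂ)) z := by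
    fun_prop
  have h3 := DifferentiableAt.comp (𝕜 := ℂ) z (g := fun p : ℂ × ℂ => jacobiTheta₂ p.1 p.2) h h2
  refine DifferentiableAt.mul ?_ h3
  fun_prop

lemma xV_differentiableAt {z : ℂ} (hz : 0 < z.im) : DifferentiableAt ℂ xV z := by
  have h : xV = fun z => toVec (thVec z) := funext xV_eq_toVec
  rw [h, differentiableAt_pi]
  intro i
  have (j : ZMod 13) : DifferentiableAt ℂ (fun z => thVec z j) z :=
    (differentiableAt_eta_of_mem_upperHalfPlaneSet hz).mul (thClass_differentiableAt j hz)
  fin_cases i <;> exact this _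

lemma eta_pow_eight_add_one (n : ℕ) (z : ℂ) :
    ModularForm.eta (z + 1) ^ (8 * n) = cexp (2 * Real.pi * I / 3) ^ n * ModularForm.eta z ^ (8 * n) := by
  rw [eta_add_one, mul_pow, ← Complex.exp_nat_mul, ← Complex.exp_nat_mul]
  congr 2
  push_cast
  ring

lemma eta_pow_eight_neg_inv (n : ℕ) {z : ℂ} (hz : 0 < z.im) :
    ModularForm.eta (-1 / z) ^ (8 * n) = z ^ (4 * n) * ModularForm.eta z ^ (8 * n) := by
  obtain ⟨s, hs, h⟩ := exists_eta_neg_inv hz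
  rw [h, mul_pow, show 8 * n = 2 * (4 * n) by ring, pow_mul s, hs, mul_pow, pow_mul (-I)]
  have : (-I) ^ 4 = 1 := by rw [neg_pow, I_pow_four]; norm_num
  rw [this, one_pow, one_mul]

lemma exists_levelOne_of_quotient {P : ℂ → ℂ} {d n w : ℕ} (hd : d = 4 * n + w) (h3 : 3 ∣ d + n)
    (hol : ∀ z : ℂ, 0 < z.im → DifferentiableAt ℂ P z)
    (hT : ∀ z : ℂ, P (z + 1) = cexp (-(2 * Real.pi * I / 3)) ^ d * P z)
    (hS : ∀ z : ℂ, 0 < z.im → P (-1 / z) = z ^ d * P z)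
    (hL : Tendsto (fun z : ℍ => P z / ModularForm.eta z ^ (8 * n)) atImInfty (𝓝 1)) :
    ∃ M : ModularForm 𝒮ℒ w, (qExpansion 1 M).coeff 0 = 1 ∧
      ∀ z : ℍ, P z = ModularForm.eta z ^ (8 * n) * M z := by
  have hη {z : ℂ} (hz : 0 < z.im) : ModularForm.eta z ^ (8 * n) ≠ 0 :=
    pow_ne_zero _ (ModularForm.eta_ne_zero hz)
  have hω : cexp (2 * Real.pi * I / 3) ^ 3 = 1 := by
    rw [← Complex.exp_nat_mul, Complex.exp_eq_one_iff]
    exact ⟨1, by push_cast; ring⟩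
  have hex := exists_levelOne_modularForm (k := w)
    (G := fun z => P z / ModularForm.eta z ^ (8 * n)) (L := 1)
  refine (hex ?_ ?_ ?_ hL).imp fun M hM => ⟨hM.1, fun z => ?_⟩
  · intro z hz
    exact ((hol z hz).div ((differentiableAt_eta_of_mem_upperHalfPlaneSet hz).pow _)
      (hη hz)).differentiableWithinAt
  · intro z hz
    obtain ⟨t, ht⟩ := h3
    have hT' : cexp (-(2 * Real.pi * I / 3)) ^ d = cexp (2 * Real.pi * I / 3) ^ n := by
      rw [Complex.exp_neg, inv_pow]
      refine inv_eq_of_mul_eq_one_right ?_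
      rw [← pow_add, ht, pow_mul, hω, one_pow]
    simp only [hT, hT', eta_pow_eight_add_one]
    rw [mul_div_mul_left _ _ (pow_ne_zero _ (Complex.exp_ne_zero _))]
  · intro z hz
    have hz0 : z ≠ 0 := by rintro rfl; simp at hz
    simp only [hS z hz, eta_pow_eight_neg_inv n hz, hd, zpow_natCast, pow_add]
    field_simp
  · rw [hM.2, mul_div_cancel₀ _ (hη z.2)]

end LevelOne

/-! ### The behaviour of the theta vector at the cusp -/

section Cusp

open UpperHalfPlane hiding I
open Filter Topology Asymptotics

/-- The local parameter `exp (2 π i z / 13)` at the cusp. -/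
def qThirteen (z : ℂ) : ℂ := cexp (2 * Real.pi * I * z / 13)

/-- The truncation of the normalised theta vector at the cusp. -/
def cuspVec (t : ℂ) : Fin 6 → ℂ := ![0, t ^ 6, t ^ 3, -t, t ^ 10, 1]

/-- The theta vector divided by its leading factor `exp (2 π i z / 104)`. -/
def thVecNormalized (z : ℂ) : Fin 6 → ℂ :=
  (cexp (2 * Real.pi * I * z / 104))⁻¹ • toVec fun j => thClass j z

lemma norm_cexp_mul_I (c : ℝ) (z : ℂ) : ‖cexp (c * I * z)‖ = Real.exp (-(c * z.im)) := by
  rw [Complex.norm_exp]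
  congr 1
  simp

lemma norm_qThirteen (z : ℂ) : ‖qThirteen z‖ = Real.exp (-(2 * Real.pi / 13 * z.im)) := by
  rw [← norm_cexp_mul_I, qThirteen]
  push_cast
  ring_nf

lemma norm_thTerm (m : ℤ) (z : ℂ) :
    ‖thTerm m z‖ = Real.exp (-(Real.pi * (2 * m - 1) ^ 2 / 52 * z.im)) := by
  rw [← norm_cexp_mul_I, thTerm, norm_mul, norm_zpow, norm_neg, norm_one, one_zpow, one_mul]
  push_cast
  ring_nf

lemma qThirteen_ne_zero (z : ℂ) : qThirteen z ≠ 0 := Complex.exp_ne_zero _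

lemma tendsto_qThirteen : Tendsto (fun z : ℍ => qThirteen z) atImInfty (𝓝 0) := by
  rw [tendsto_zero_iff_norm_tendsto_zero]
  simp only [norm_qThirteen]
  refine Real.tendsto_exp_neg_atTop_nhds_zero.comp ?_
  exact Tendsto.const_mul_atTop (by positivity) tendsto_comap

lemma thTerm_eq_qThirteen (r : ℕ) (z : ℂ) :
    thTerm (r + 1) z =
      cexp (2 * Real.pi * I * z / 104) * ((-1) ^ r * qThirteen z ^ (r * (r + 1) / 2)) := by
  have h : ((r * (r + 1) / 2 : ℕ) : ℂ) = r * (r + 1) / 2 := by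
    rw [Nat.cast_div (Nat.even_mul_succ_self r).two_dvd (by norm_num)]
    push_cast; ring
  have hs : (-1 : ℂ) ^ ((r : ℤ) + 1 + 1) = (-1) ^ r := by
    rw [add_assoc, zpow_add₀ (by norm_num), zpow_natCast]
    norm_num
  rw [thTerm, qThirteen, ← Complex.exp_nat_mul, h, mul_left_comm, ← Complex.exp_add, hs]
  push_cast
  ring_nf

lemma thClass_isBigO (r : ℕ) (hr : r < 6) :
    (fun z : ℍ => (cexp (2 * Real.pi * I * z / 104))⁻¹ *
      thClass ((2 * r + 1 : ℤ) : ZMod 13) z - (-1) ^ r * qThirteen z ^ (r * (r + 1) / 2))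
      =O[atImInfty] fun z : ℍ => qThirteen z ^ 15 := by
  have hsum {z : ℂ} (hz : 0 < z.im) : Summable fun n : ℤ => thTerm (13 * n + (r + 1)) z :=
    (summable_thTerm hz).comp_injective (i := fun n : ℤ => 13 * n + (r + 1 : ℤ))
      fun a b h => by simp only at h; omega
  obtain ⟨C, hC⟩ := (hsum (z := I) (by simp)).norm
  refine IsBigO.of_bound (Real.exp (Real.pi * 121 / 52) * C) ?_
  have hev : ∀ᶠ z : ℍ in atImInfty, 1 ≤ z.im := (atImInfty_mem _).2 ⟨1, fun _ h => h⟩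
  filter_upwards [hev] with z hz
  set s := cexp (2 * Real.pi * I * z / 104) with hs
  have hs0 : s ≠ 0 := Complex.exp_ne_zero _
  have hmain : thClass ((2 * r + 1 : ℤ) : ZMod 13) z - thTerm (r + 1) z =
      ∑' n : ℤ, if n = 0 then 0 else thTerm (13 * n + (r + 1)) z := by
    have := thClass_eq_tsum (r + 1) z
    rw [(hsum z.2).tsum_eq_add_tsum_ite 0, show 2 * ((r : ℤ) + 1) - 1 = 2 * r + 1 by ring] at this
    rw [this]
    simp
  have hbound : ‖thClass ((2 * r + 1 : ℤ) : ZMod 13) z - thTerm (r + 1) z‖ ≤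
      Real.exp (-(Real.pi * 121 / 52 * (z.im - 1))) * C := by
    rw [hmain]
    refine tsum_of_norm_bounded (hC.mul_left _) fun n => ?_
    split_ifs with hn
    · rw [norm_zero]; positivity
    · rw [norm_thTerm, norm_thTerm, ← Real.exp_add, Real.exp_le_exp]
      have h121 : (121 : ℝ) ≤ (2 * ((13 * n + (r + 1) : ℤ) : ℝ) - 1) ^ 2 := by
        have : (121 : ℤ) ≤ (2 * (13 * n + (r + 1)) - 1) ^ 2 := by
          rcases lt_or_gt_of_ne hn with h | h
          · nlinarith [show (2 * (13 * n + (r + 1)) - 1) ≤ -11 by omega]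
          · nlinarith [show 11 ≤ (2 * (13 * n + (r + 1)) - 1) by omega]
        exact_mod_cast this
      have hz' : (0 : ℝ) ≤ z.im - 1 := by linarith
      have := mul_le_mul_of_nonneg_right h121 (mul_nonneg Real.pi_pos.le hz')
      simp only [Complex.I_im, UpperHalfPlane.coe_im]
      nlinarith
  have hs15 : ‖s‖ * ‖qThirteen z ^ 15‖ = Real.exp (-(Real.pi * 121 / 52 * z.im)) := by
    have : ‖s‖ = Real.exp (-(2 * Real.pi / 104 * z.im)) := by
      rw [← UpperHalfPlane.coe_im, ← norm_cexp_mul_I, hs]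
      push_cast
      ring_nf
    rw [norm_pow, norm_qThirteen, this, ← Real.exp_nat_mul, ← Real.exp_add]
    congr 1
    simp only [UpperHalfPlane.coe_im]
    push_cast
    ring
  have heq : s⁻¹ * thClass ((2 * r + 1 : ℤ) : ZMod 13) z -
      (-1) ^ r * qThirteen z ^ (r * (r + 1) / 2) =
      s⁻¹ * (thClass ((2 * r + 1 : ℤ) : ZMod 13) z - thTerm (r + 1) z) := by
    rw [thTerm_eq_qThirteen, ← hs]
    field_simp
  rw [heq, norm_mul, norm_inv, inv_mul_le_iff₀ (norm_pos_iff.2 hs0)]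
  refine hbound.trans (le_of_eq ?_)
  calc _ = Real.exp (Real.pi * 121 / 52) * C * Real.exp (-(Real.pi * 121 / 52 * z.im)) := by
        rw [mul_right_comm, ← Real.exp_add]
        ring_nf
    _ = _ := by rw [← hs15]; ring

lemma thVecNormalized_isBigO :
    (fun z : ℍ => thVecNormalized z - cuspVec (qThirteen z)) =O[atImInfty]
      fun z : ℍ => qThirteen z ^ 15 := by
  rw [isBigO_pi]
  have hodd (j : ZMod 13) (z : ℂ) : thClass (-j) z = -thClass j z := thClass_odd z j
  intro i
  fin_cases i
  · refine (thClass_isBigO 5 (by norm_num)).neg_left.add (isBigO_refl _ _) |>.congr_left fun z => ?_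
    have := hodd 11 z
    rw [show (-11 : ZMod 13) = 2 from rfl] at this
    norm_num [thVecNormalized, cuspVec, toVec, this]
  · refine (thClass_isBigO 3 (by norm_num)).neg_left.congr_left fun z => ?_
    have := hodd 7 z
    rw [show (-7 : ZMod 13) = 6 from rfl] at this
    norm_num [thVecNormalized, cuspVec, toVec, this]
    ring
  · exact (thClass_isBigO 2 (by norm_num)).congr_left fun z => by
      norm_num [thVecNormalized, cuspVec, toVec]
  · exact (thClass_isBigO 1 (by norm_num)).congr_left fun z => by
      norm_num [thVecNormalized, cuspVec, toVec]
  · exact (thClass_isBigO 4 (by norm_num)).congr_left fun z => by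
      norm_num [thVecNormalized, cuspVec, toVec]
  · exact (thClass_isBigO 0 (by norm_num)).congr_left fun z => by
      norm_num [thVecNormalized, cuspVec, toVec]

lemma continuous_cuspVec : Continuous cuspVec := by
  unfold cuspVec
  fun_prop

lemma tendsto_cuspVec : Tendsto (fun z : ℍ => cuspVec (qThirteen z)) atImInfty (𝓝 (cuspVec 0)) :=
  (continuous_cuspVec.tendsto 0).comp tendsto_qThirteen

lemma tendsto_thVecNormalized :
    Tendsto (fun z : ℍ => thVecNormalized z) atImInfty (𝓝 (cuspVec 0)) := by
  have h : Tendsto (fun z : ℍ => qThirteen z ^ 15) atImInfty (𝓝 0) := by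
    simpa using tendsto_qThirteen.pow 15
  simpa using (thVecNormalized_isBigO.trans_tendsto h).add tendsto_cuspVec

lemma isBigO_comp_thVecNormalized {Q : (Fin 6 → ℂ) → ℂ} (hQ : ContDiff ℂ 1 Q) :
    (fun z : ℍ => Q (thVecNormalized z) - Q (cuspVec (qThirteen z))) =O[atImInfty]
      fun z : ℍ => qThirteen z ^ 15 :=
  ((hQ.contDiffAt.hasStrictFDerivAt (x := cuspVec 0) one_ne_zero).isBigO_sub.comp_tendsto
    (tendsto_thVecNormalized.prodMk_nhds tendsto_cuspVec)).trans thVecNormalized_isBigO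

lemma tendsto_comp_thVecNormalized {Q : (Fin 6 → ℂ) → ℂ} (hQ : ContDiff ℂ 1 Q) {N M : ℕ}
    (hN : N < 15) (hM : N < M) {S : ℂ → ℂ} (hS : Continuous S)
    (h : ∀ t, Q (cuspVec t) = t ^ N + t ^ M * S t) :
    Tendsto (fun z : ℍ => Q (thVecNormalized z) / qThirteen z ^ N) atImInfty (𝓝 1) := by
  have ht0 := tendsto_qThirteen
  have h1 : Tendsto (fun z : ℍ => (Q (thVecNormalized z) - Q (cuspVec (qThirteen z))) /
      qThirteen z ^ N) atImInfty (𝓝 0) := by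
    refine IsLittleO.tendsto_div_nhds_zero ((isBigO_comp_thVecNormalized hQ).trans_isLittleO ?_)
    exact (isLittleO_pow_pow (𝕜 := ℂ) hN).comp_tendsto ht0
  have h2 : Tendsto (fun z : ℍ => 1 + qThirteen z ^ (M - N) * S (qThirteen z)) atImInfty
      (𝓝 1) := by
    have hc : Continuous fun t : ℂ => 1 + t ^ (M - N) * S t := by fun_prop
    have := (hc.tendsto 0).comp ht0
    simpa [Function.comp_def, zero_pow (Nat.sub_pos_of_lt hM).ne'] using this
  rw [show (1 : ℂ) = 0 + 1 by ring]
  refine (h1.add h2).congr fun z => ?_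
  have := qThirteen_ne_zero z
  rw [h, show qThirteen z ^ M = qThirteen z ^ N * qThirteen z ^ (M - N) by
    rw [← pow_add, Nat.add_sub_cancel' hM.le]]
  field_simp
  ring

/-- The Euler product `∏ (1 - q ^ (n + 1))`. -/
def eulerProd (z : ℂ) : ℂ := ∏' n : ℕ, (1 - ModularForm.eta_q n z)

lemma tendsto_eulerProd : Tendsto (fun z : ℍ => eulerProd z) atImInfty (𝓝 1) := by
  have h := (ModularForm.differentiableOn_tprod_one_sub_pow.continuousOn.continuousAt
    (Metric.ball_mem_nhds (0 : ℂ) one_pos)).tendsto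
  have := h.comp (UpperHalfPlane.qParam_tendsto_atImInfty zero_lt_one)
  simp only [ne_eq, Nat.add_eq_zero_iff, one_ne_zero, and_false, not_false_eq_true, zero_pow,
    sub_zero, tprod_one] at this
  refine this.congr fun z => ?_
  simp [eulerProd, ModularForm.eta_q, Function.Periodic.qParam]

lemma tendsto_comp_xV_div_eta_pow {Q : (Fin 6 → ℂ) → ℂ} {d n N : ℕ}
    (hQ : ∀ (c : ℂ) v, Q (c • v) = c ^ d * Q v) (hd : 2 * d + 3 * N = 13 * n)
    (h : Tendsto (fun z : ℍ => Q (thVecNormalized z) / qThirteen z ^ N) atImInfty (𝓝 1)) :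
    Tendsto (fun z : ℍ => Q (xV z) / ModularForm.eta z ^ (8 * n)) atImInfty (𝓝 1) := by
  have hE := (tendsto_eulerProd.pow d).div (tendsto_eulerProd.pow (8 * n)) (by simp)
  have := hE.mul h
  rw [one_pow, one_pow, div_one, one_mul] at this
  refine this.congr fun z => ?_
  set r := cexp (2 * Real.pi * I * z / 312) with hr
  have hr0 : r ≠ 0 := Complex.exp_ne_zero _
  have hη : ModularForm.eta z = r ^ 13 * eulerProd z := by
    rw [ModularForm.eta, eulerProd, hr, ← Complex.exp_nat_mul, Function.Periodic.qParam]
    congr 2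
    push_cast
    ring
  have hE0 : eulerProd z ≠ 0 := ModularForm.eta_tprod_ne_zero z.2
  have hx : xV z = (r ^ 16 * eulerProd z) • thVecNormalized z := by
    have hs : r ^ 3 = cexp (2 * Real.pi * I * z / 104) := by
      rw [hr, ← Complex.exp_nat_mul]
      congr 1
      push_cast
      ring
    rw [xV_eq_toVec, thVecNormalized, ← hs, smul_smul, ← toVec_smul]
    congr 1
    ext j
    rw [thVec, Pi.smul_apply, hη, smul_eq_mul]
    field_simp
  have ht : qThirteen z = r ^ 24 := by
    rw [qThirteen, hr, ← Complex.exp_nat_mul]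
    congr 1
    push_cast
    ring
  rw [hx, hQ, hη, ht, mul_pow, mul_pow, ← pow_mul, ← pow_mul, ← pow_mul,
    show 13 * (8 * n) = 16 * d + 24 * N by omega, pow_add, Pi.div_apply]
  field_simp

end Cusp

/-! ### Expansions at the cusp -/

/-- Congruence modulo `t ^ N`, with a continuous cofactor. -/
def EqMod (N : ℕ) (f g : ℂ → ℂ) : Prop :=
  ∃ S : ℂ → ℂ, Continuous S ∧ ∀ t, f t = g t + t ^ N * S t

/-- The polynomial function with coefficients `c`. -/
def truncPoly {N : ℕ} (c : Fin N → ℂ) (t : ℂ) : ℂ := ∑ n, c n * t ^ (n : ℕ)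

lemma continuous_truncPoly {N : ℕ} (c : Fin N → ℂ) : Continuous (truncPoly c) := by
  unfold truncPoly
  fun_prop

lemma EqMod.trans {N : ℕ} {f g h : ℂ → ℂ} (h₁ : EqMod N f g) (h₂ : EqMod N g h) : EqMod N f h := by
  obtain ⟨S, hS, h₁⟩ := h₁
  obtain ⟨T, hT, h₂⟩ := h₂
  exact ⟨fun t => T t + S t, hT.add hS, fun t => by rw [h₁, h₂]; ring⟩

lemma EqMod.congr_left {N : ℕ} {f f' g : ℂ → ℂ} (h : EqMod N f g) (hf : ∀ t, f' t = f t) :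
    EqMod N f' g := by
  rwa [show f' = f from funext hf]

lemma EqMod.mul {N m n : ℕ} {f g : ℂ → ℂ} {a : Fin m → ℂ} {b : Fin n → ℂ}
    (hf : EqMod N f (truncPoly a)) (hg : EqMod N g (truncPoly b)) :
    EqMod N (fun t => f t * g t) (fun t => truncPoly a t * truncPoly b t) := by
  obtain ⟨S, hS, hf⟩ := hf
  obtain ⟨T, hT, hg⟩ := hg
  have ha := continuous_truncPoly a
  have hb := continuous_truncPoly b
  exact ⟨fun t => truncPoly a t * T t + S t * truncPoly b t + t ^ N * S t * T t, by fun_prop,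
    fun t => by simp only [hf, hg]; ring⟩

lemma sum_zeta_pow (m : ℕ) :
    ∑ ν ∈ Finset.range 13, (ζ ^ ν) ^ m = if 13 ∣ m then 13 else 0 := by
  simp only [← pow_mul, mul_comm _ m]
  simp only [pow_mul]
  split_ifs with h
  · obtain ⟨k, rfl⟩ := h
    simp [pow_mul, zeta_pow_thirteen]
  · have hζ : IsPrimitiveRoot ζ 13 := by
      simpa [ζ] using Complex.isPrimitiveRoot_exp 13 (by norm_num)
    refine (hζ.pow_of_coprime m ?_).geom_sum_eq_zero (by norm_num)
    exact ((Nat.Prime.coprime_iff_not_dvd (by norm_num)).2 h).symm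

lemma EqMod.sum_twist {N : ℕ} {f : ℂ → ℂ} {c : Fin N → ℂ} (h : EqMod N f (truncPoly c)) (e : ℕ) :
    EqMod N (fun t => ∑ ν ∈ Finset.range 13, (ζ ^ ν) ^ e * f (ζ ^ ν * t))
      (fun t => 13 * ∑ n : Fin N, if 13 ∣ e + n then c n * t ^ (n : ℕ) else 0) := by
  obtain ⟨S, hS, h⟩ := h
  refine ⟨fun t => ∑ ν ∈ Finset.range 13, (ζ ^ ν) ^ (e + N) * S (ζ ^ ν * t), by fun_prop,
    fun t => ?_⟩
  simp only [h, mul_add, Finset.sum_add_distrib]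
  congr 1
  · simp only [truncPoly, Finset.mul_sum]
    rw [Finset.sum_comm]
    refine Finset.sum_congr rfl fun n _ => ?_
    calc _ = c n * t ^ (n : ℕ) * ∑ ν ∈ Finset.range 13, (ζ ^ ν) ^ (e + n) := by
          rw [Finset.mul_sum]
          refine Finset.sum_congr rfl fun ν _ => ?_
          rw [mul_pow, pow_add]; ring
      _ = _ := by
          rw [sum_zeta_pow]
          split_ifs <;> ring
  · rw [Finset.mul_sum]
    refine Finset.sum_congr rfl fun ν _ => ?_
    rw [mul_pow, pow_add]; ring

lemma twist_cuspVec {u : ℂ} (hu : u ^ 13 = 1) (t : ℂ) :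
    twist u (cuspVec t) = u ^ 5 • cuspVec (u * t) := by
  ext i
  fin_cases i <;> simp [twist, cuspVec] <;>
    first | ring1 | linear_combination (-u ^ 2 * t ^ 10) * hu

lemma wF_smul (ν : ℕ) (c : ℂ) (v : Fin 6 → ℂ) : wF ν (c • v) = c ^ 4 * wF ν v := by
  simp only [wF, AA0, AA1, AA2, AA3, AA4, AA5, AA6, Pi.smul_apply, smul_eq_mul]
  ring

lemma wInf_smul (c : ℂ) (v : Fin 6 → ℂ) : wInf (c • v) = c ^ 4 * wInf v := by
  simp only [wInf, AA0, Pi.smul_apply, smul_eq_mul]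
  ring

lemma DD0_smul (c : ℂ) (v : Fin 6 → ℂ) : DD0 (c • v) = c ^ 3 * DD0 v := by
  simp only [DD0, Pi.smul_apply, smul_eq_mul]
  ring

lemma DD1_smul (c : ℂ) (v : Fin 6 → ℂ) : DD1 (c • v) = c ^ 3 * DD1 v := by
  simp only [DD1, Pi.smul_apply, smul_eq_mul]
  ring

lemma DD2_smul (c : ℂ) (v : Fin 6 → ℂ) : DD2 (c • v) = c ^ 3 * DD2 v := by
  simp only [DD2, Pi.smul_apply, smul_eq_mul]
  ring

lemma DD3_smul (c : ℂ) (v : Fin 6 → ℂ) : DD3 (c • v) = c ^ 3 * DD3 v := by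
  simp only [DD3, Pi.smul_apply, smul_eq_mul]
  ring

lemma DD4_smul (c : ℂ) (v : Fin 6 → ℂ) : DD4 (c • v) = c ^ 3 * DD4 v := by
  simp only [DD4, Pi.smul_apply, smul_eq_mul]
  ring

lemma DD5_smul (c : ℂ) (v : Fin 6 → ℂ) : DD5 (c • v) = c ^ 3 * DD5 v := by
  simp only [DD5, Pi.smul_apply, smul_eq_mul]
  ring

lemma DD6_smul (c : ℂ) (v : Fin 6 → ℂ) : DD6 (c • v) = c ^ 3 * DD6 v := by
  simp only [DD6, Pi.smul_apply, smul_eq_mul]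
  ring

lemma DD7_smul (c : ℂ) (v : Fin 6 → ℂ) : DD7 (c • v) = c ^ 3 * DD7 v := by
  simp only [DD7, Pi.smul_apply, smul_eq_mul]
  ring

lemma DD8_smul (c : ℂ) (v : Fin 6 → ℂ) : DD8 (c • v) = c ^ 3 * DD8 v := by
  simp only [DD8, Pi.smul_apply, smul_eq_mul]
  ring

lemma DD9_smul (c : ℂ) (v : Fin 6 → ℂ) : DD9 (c • v) = c ^ 3 * DD9 v := by
  simp only [DD9, Pi.smul_apply, smul_eq_mul]
  ring

lemma DD10_smul (c : ℂ) (v : Fin 6 → ℂ) : DD10 (c • v) = c ^ 3 * DD10 v := by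
  simp only [DD10, Pi.smul_apply, smul_eq_mul]
  ring

lemma DD11_smul (c : ℂ) (v : Fin 6 → ℂ) : DD11 (c • v) = c ^ 3 * DD11 v := by
  simp only [DD11, Pi.smul_apply, smul_eq_mul]
  ring

lemma DD12_smul (c : ℂ) (v : Fin 6 → ℂ) : DD12 (c • v) = c ^ 3 * DD12 v := by
  simp only [DD12, Pi.smul_apply, smul_eq_mul]
  ring

lemma DDinf_smul (c : ℂ) (v : Fin 6 → ℂ) : DDinf (c • v) = c ^ 3 * DDinf v := by
  simp only [DDinf, Pi.smul_apply, smul_eq_mul]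
  ring

lemma GG0_smul (c : ℂ) (v : Fin 6 → ℂ) : GG0 (c • v) = c ^ 6 * GG0 v := by
  simp only [GG0, DD0_smul, DDinf_smul]
  ring

lemma GG1_smul (c : ℂ) (v : Fin 6 → ℂ) : GG1 (c • v) = c ^ 6 * GG1 v := by
  simp only [GG1, DD0_smul, DD1_smul, DD2_smul, DD3_smul, DD4_smul, DD5_smul, DD7_smul,
    DD9_smul, DD10_smul, DD11_smul, DD12_smul, DDinf_smul]
  ring

lemma GG2_smul (c : ℂ) (v : Fin 6 → ℂ) : GG2 (c • v) = c ^ 6 * GG2 v := by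
  simp only [GG2, DD0_smul, DD1_smul, DD2_smul, DD4_smul, DD5_smul, DD6_smul, DD7_smul,
    DD8_smul, DD9_smul, DD10_smul, DD11_smul, DDinf_smul]
  ring

lemma GG3_smul (c : ℂ) (v : Fin 6 → ℂ) : GG3 (c • v) = c ^ 6 * GG3 v := by
  simp only [GG3, DD0_smul, DD1_smul, DD2_smul, DD3_smul, DD4_smul, DD6_smul, DD7_smul,
    DD8_smul, DD9_smul, DD10_smul, DD12_smul, DDinf_smul]
  ring

lemma GG4_smul (c : ℂ) (v : Fin 6 → ℂ) : GG4 (c • v) = c ^ 6 * GG4 v := by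
  simp only [GG4, DD0_smul, DD1_smul, DD2_smul, DD3_smul, DD4_smul, DD5_smul, DD7_smul,
    DD8_smul, DD9_smul, DD10_smul, DD12_smul, DDinf_smul]
  ring

lemma GG5_smul (c : ℂ) (v : Fin 6 → ℂ) : GG5 (c • v) = c ^ 6 * GG5 v := by
  simp only [GG5, DD0_smul, DD2_smul, DD3_smul, DD5_smul, DD6_smul, DD7_smul, DD8_smul,
    DD9_smul, DD10_smul, DD11_smul, DD12_smul, DDinf_smul]
  ring

lemma GG6_smul (c : ℂ) (v : Fin 6 → ℂ) : GG6 (c • v) = c ^ 6 * GG6 v := by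
  simp only [GG6, DD0_smul, DD1_smul, DD2_smul, DD3_smul, DD4_smul, DD5_smul, DD6_smul,
    DD7_smul, DD8_smul, DD11_smul, DD12_smul, DDinf_smul]
  ring

lemma GG7_smul (c : ℂ) (v : Fin 6 → ℂ) : GG7 (c • v) = c ^ 6 * GG7 v := by
  simp only [GG7, DD0_smul, DD1_smul, DD2_smul, DD5_smul, DD6_smul, DD7_smul, DD8_smul,
    DD9_smul, DD10_smul, DD11_smul, DD12_smul, DDinf_smul]
  ring

lemma GG8_smul (c : ℂ) (v : Fin 6 → ℂ) : GG8 (c • v) = c ^ 6 * GG8 v := by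
  simp only [GG8, DD0_smul, DD1_smul, DD2_smul, DD3_smul, DD4_smul, DD5_smul, DD6_smul,
    DD7_smul, DD8_smul, DD10_smul, DD11_smul, DDinf_smul]
  ring

lemma GG9_smul (c : ℂ) (v : Fin 6 → ℂ) : GG9 (c • v) = c ^ 6 * GG9 v := by
  simp only [GG9, DD0_smul, DD1_smul, DD3_smul, DD4_smul, DD5_smul, DD6_smul, DD8_smul,
    DD9_smul, DD10_smul, DD11_smul, DD12_smul, DDinf_smul]
  ring

lemma GG10_smul (c : ℂ) (v : Fin 6 → ℂ) : GG10 (c • v) = c ^ 6 * GG10 v := by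
  simp only [GG10, DD0_smul, DD1_smul, DD3_smul, DD4_smul, DD5_smul, DD6_smul, DD7_smul,
    DD9_smul, DD10_smul, DD11_smul, DD12_smul, DDinf_smul]
  ring

lemma GG11_smul (c : ℂ) (v : Fin 6 → ℂ) : GG11 (c • v) = c ^ 6 * GG11 v := by
  simp only [GG11, DD0_smul, DD2_smul, DD3_smul, DD4_smul, DD5_smul, DD6_smul, DD7_smul,
    DD8_smul, DD9_smul, DD11_smul, DD12_smul, DDinf_smul]
  ring

lemma GG12_smul (c : ℂ) (v : Fin 6 → ℂ) : GG12 (c • v) = c ^ 6 * GG12 v := by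
  simp only [GG12, DD0_smul, DD1_smul, DD2_smul, DD3_smul, DD4_smul, DD6_smul, DD8_smul,
    DD9_smul, DD10_smul, DD11_smul, DD12_smul, DDinf_smul]
  ring

lemma dF_smul (ν : ℕ) (c : ℂ) (v : Fin 6 → ℂ) : dF ν (c • v) = c ^ 6 * dF ν v := by
  simp only [dF, GG0_smul, GG1_smul, GG2_smul, GG3_smul, GG4_smul, GG5_smul, GG6_smul, GG7_smul,
    GG8_smul, GG9_smul, GG10_smul, GG11_smul, GG12_smul]
  ring

lemma dInf_smul (c : ℂ) (v : Fin 6 → ℂ) : dInf (c • v) = c ^ 6 * dInf v := by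
  simp only [dInf, GG0_smul]
  ring

lemma wF_cuspVec_eq (ν : ℕ) (t : ℂ) :
    wF ν (cuspVec t) = (ζ ^ ν) ^ 20 * wF 0 (cuspVec (ζ ^ ν * t)) := by
  rw [← wF_twist _ (zeta_pow_pow_thirteen ν) ν rfl, twist_cuspVec (zeta_pow_pow_thirteen ν), wF_smul]
  ring

lemma dF_cuspVec_eq (ν : ℕ) (t : ℂ) :
    dF ν (cuspVec t) = (ζ ^ ν) ^ 30 * dF 0 (cuspVec (ζ ^ ν * t)) := by
  rw [← dF_twist _ (zeta_pow_pow_thirteen ν) ν rfl, twist_cuspVec (zeta_pow_pow_thirteen ν), dF_smul]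
  ring

lemma wInf_cuspVec (t : ℂ) : wInf (cuspVec t) = 13 * (t ^ 3 * (1 + t ^ 13)) ^ 2 := by
  simp [wInf, AA0, cuspVec]
  ring

lemma dInf_cuspVec (t : ℂ) : dInf (cuspVec t) = 169 * t ^ 22 := by
  simp [dInf, GG0, DD0, DDinf, cuspVec]
  ring

lemma exists_wF_sum {k : ℕ} (hk : 3 ≤ k) {c : Fin 15 → ℂ}
    (h : EqMod 15 (fun t => wF 0 (cuspVec t) ^ k) (truncPoly c)) :
    EqMod 15 (fun t => ∑ ν ∈ Finset.range 13, wF ν (cuspVec t) ^ k + wInf (cuspVec t) ^ k)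
      (fun t => 13 * ∑ n : Fin 15, if 13 ∣ 20 * k + n then c n * t ^ (n : ℕ) else 0) := by
  obtain ⟨S, hS, h⟩ := h.sum_twist (20 * k)
  refine ⟨fun t => S t + 13 ^ k * t ^ (6 * k - 15) * (1 + t ^ 13) ^ (2 * k), by fun_prop,
    fun t => ?_⟩
  have hsum : ∑ ν ∈ Finset.range 13, wF ν (cuspVec t) ^ k =
      ∑ ν ∈ Finset.range 13, (ζ ^ ν) ^ (20 * k) * wF 0 (cuspVec (ζ ^ ν * t)) ^ k :=
    Finset.sum_congr rfl fun ν _ => by rw [wF_cuspVec_eq, mul_pow, pow_mul]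
  have hpow : t ^ (6 * k) = t ^ 15 * t ^ (6 * k - 15) := by
    rw [← pow_add]
    congr 1
    omega
  simp only at h ⊢
  rw [hsum, h, wInf_cuspVec, mul_pow, ← pow_mul, mul_pow (t ^ 3), ← pow_mul t,
    show 3 * (2 * k) = 6 * k by ring, hpow]
  ring

lemma exists_dF_sum {k : ℕ} (hk : 1 ≤ k) {c : Fin 12 → ℂ}
    (h : EqMod 12 (fun t => dF 0 (cuspVec t) ^ k) (truncPoly c)) :
    EqMod 12 (fun t => ∑ ν ∈ Finset.range 13, dF ν (cuspVec t) ^ k + dInf (cuspVec t) ^ k)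
      (fun t => 13 * ∑ n : Fin 12, if 13 ∣ 30 * k + n then c n * t ^ (n : ℕ) else 0) := by
  obtain ⟨S, hS, h⟩ := h.sum_twist (30 * k)
  refine ⟨fun t => S t + 169 ^ k * t ^ (22 * k - 12), by fun_prop, fun t => ?_⟩
  have hsum : ∑ ν ∈ Finset.range 13, dF ν (cuspVec t) ^ k =
      ∑ ν ∈ Finset.range 13, (ζ ^ ν) ^ (30 * k) * dF 0 (cuspVec (ζ ^ ν * t)) ^ k :=
    Finset.sum_congr rfl fun ν _ => by rw [dF_cuspVec_eq, mul_pow, pow_mul]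
  have hpow : t ^ (22 * k) = t ^ 12 * t ^ (22 * k - 12) := by
    rw [← pow_add]
    congr 1
    omega
  simp only at h ⊢
  rw [hsum, h, dInf_cuspVec, mul_pow, ← pow_mul, hpow]
  ring

/-- The coefficients of the `1`-th power of `t ↦ wF 0 (cuspVec t)` modulo `t ^ 15`. -/
def wFCoeff1 : Fin 15 → ℂ :=
  ![1, 0, 2, -2, -3, -2, -1, 0, 6, -6, 0, 8, -1, 0, 2]

/-- The coefficients of the `2`-th power of `t ↦ wF 0 (cuspVec t)` modulo `t ^ 15`. -/
def wFCoeff2 : Fin 15 → ℂ :=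
  ![1, 0, 4, -4, -2, -12, -10, 4, 25, 4, 34, -28, -13, 44, -20]

/-- The coefficients of the `3`-th power of `t ↦ wF 0 (cuspVec t)` modulo `t ^ 15`. -/
def wFCoeff3 : Fin 15 → ℂ :=
  ![1, 0, 6, -6, 3, -30, -19, -12, 45, 70, 156, -90, -15, -174, -147]

/-- The coefficients of the `5`-th power of `t ↦ wF 0 (cuspVec t)` modulo `t ^ 15`. -/
def wFCoeff5 : Fin 15 → ℂ :=
  ![1, 0, 10, -10, 25, -90, -5, -200, 120, 210, 912, 420, 695, -2860, -1920]

/-- The coefficients of the `8`-th power of `t ↦ wF 0 (cuspVec t)` modulo `t ^ 15`. -/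
def wFCoeff8 : Fin 15 → ℂ :=
  ![1, 0, 16, -16, 88, -240, 216, -1232, 860, -1840, 5768, 2080, 14412, -9856, -5736]

/-- The coefficients of the `11`-th power of `t ↦ wF 0 (cuspVec t)` modulo `t ^ 15`. -/
def wFCoeff11 : Fin 15 → ℂ :=
  ![1, 0, 22, -22, 187, -462, 869, -3740, 4081, -13706, 25564, -20482, 103697, -51238, 146905]

lemma wF_cuspVec : EqMod 15 (fun t => wF 0 (cuspVec t)) (truncPoly wFCoeff1) := by
  refine ⟨fun t => 6 - 2 * t - 8 * t ^ 2 - 4 * t ^ 3 + 10 * t ^ 4 - 2 * t ^ 5 + 2 * t ^ 8 - 3 * t ^ 9 - 4 * t ^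
    10 + 6 * t ^ 11 - 4 * t ^ 12 + 2 * t ^ 13 - 4 * t ^ 14 - t ^ 17 + 4 * t ^ 18 - 2 * t ^ 21 +
    t ^ 25, by fun_prop, fun t => ?_⟩
  simp only [wF, AA0, AA1, AA2, AA3, AA4, AA5, AA6]
  simp [truncPoly, wFCoeff1, Fin.sum_univ_succ, cuspVec]
  ring

lemma wF_pow_2 : EqMod 15 (fun t => wF 0 (cuspVec t) ^ 2) (truncPoly wFCoeff2) := by
  refine ((wF_cuspVec.mul wF_cuspVec).trans ⟨fun t =>
    -32 + 18 * t - 92 * t ^ 2 + 26 * t ^ 3 + 88 * t ^ 4 - 112 * t ^ 5 + 12 * t ^ 6 + 88 * t ^ 7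
    - 40 * t ^ 8 + t ^ 9 + 32 * t ^ 10 - 4 * t ^ 11 + 4 * t ^ 13, by fun_prop, fun t => ?_⟩).congr_left fun t => by ring
  simp [truncPoly, wFCoeff1, wFCoeff2, Fin.sum_univ_succ]
  ring

lemma wF_pow_3 : EqMod 15 (fun t => wF 0 (cuspVec t) ^ 3) (truncPoly wFCoeff3) := by
  refine ((wF_cuspVec.mul wF_pow_2).trans ⟨fun t =>
    198 - 27 * t - 240 * t ^ 2 + 203 * t ^ 3 - 204 * t ^ 4 + 97 * t ^ 5 + 618 * t ^ 6 - 592 * t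
    ^ 7 + 52 * t ^ 8 + 433 * t ^ 9 - 260 * t ^ 10 - 6 * t ^ 11 + 88 * t ^ 12 - 40 * t ^ 13, by fun_prop, fun t => ?_⟩).congr_left fun t => by ring
  simp [truncPoly, wFCoeff1, wFCoeff2, wFCoeff3, Fin.sum_univ_succ]
  ring

lemma wF_pow_5 : EqMod 15 (fun t => wF 0 (cuspVec t) ^ 5) (truncPoly wFCoeff5) := by
  refine ((wF_pow_2.mul wF_pow_3).trans ⟨fun t =>
    -3986 + 786 * t + 5336 * t ^ 2 + 7085 * t ^ 3 + 2858 * t ^ 4 + 2650 * t ^ 5 - 11116 * t ^ 6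
    - 2209 * t ^ 7 + 550 * t ^ 8 - 7011 * t ^ 9 + 7518 * t ^ 10 - 5445 * t ^ 11 - 2988 * t ^ 12
    + 2940 * t ^ 13, by fun_prop, fun t => ?_⟩).congr_left fun t => by ring
  simp [truncPoly, wFCoeff2, wFCoeff3, wFCoeff5, Fin.sum_univ_succ]
  ring

lemma wF_pow_8 : EqMod 15 (fun t => wF 0 (cuspVec t) ^ 8) (truncPoly wFCoeff8) := by
  refine ((wF_pow_3.mul wF_pow_5).trans ⟨fun t =>
    -80090 - 26108 * t - 51264 * t ^ 2 + 166315 * t ^ 3 + 225400 * t ^ 4 + 288582 * t ^ 5 -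
    68200 * t ^ 6 - 283840 * t ^ 7 - 838968 * t ^ 8 - 259689 * t ^ 9 + 33030 * t ^ 10 + 424275 *
    t ^ 11 + 754500 * t ^ 12 + 282240 * t ^ 13, by fun_prop, fun t => ?_⟩).congr_left fun t => by ring
  simp [truncPoly, wFCoeff3, wFCoeff5, wFCoeff8, Fin.sum_univ_succ]
  ring

lemma wF_pow_11 : EqMod 15 (fun t => wF 0 (cuspVec t) ^ 11) (truncPoly wFCoeff11) := by
  refine ((wF_pow_3.mul wF_pow_8).trans ⟨fun t =>
    -375992 - 75088 * t - 779840 * t ^ 2 + 381068 * t ^ 3 + 335496 * t ^ 4 + 2256520 * t ^ 5 +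
    498576 * t ^ 6 + 1220252 * t ^ 7 - 4000488 * t ^ 8 - 1433772 * t ^ 9 - 2149368 * t ^ 10 -
    317580 * t ^ 11 + 2446896 * t ^ 12 + 843192 * t ^ 13, by fun_prop, fun t => ?_⟩).congr_left fun t => by ring
  simp [truncPoly, wFCoeff3, wFCoeff8, wFCoeff11, Fin.sum_univ_succ]
  ring

/-- The coefficients of the `1`-th power of `t ↦ dF 0 (cuspVec t)` modulo `t ^ 12`. -/
def dFCoeff1 : Fin 12 → ℂ :=
  ![-1, 2, 2, -2, -8, 6, 1, -8, 17, 0, 13, -22]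

/-- The coefficients of the `2`-th power of `t ↦ dF 0 (cuspVec t)` modulo `t ^ 12`. -/
def dFCoeff2 : Fin 12 → ℂ :=
  ![1, -4, 0, 12, 12, -52, -6, 76, -22, -64, 94, 168]

/-- The coefficients of the `3`-th power of `t ↦ dF 0 (cuspVec t)` modulo `t ^ 12`. -/
def dFCoeff3 : Fin 12 → ℂ :=
  ![-1, 6, -6, -22, 12, 138, -121, -324, 291, 616, -753, -726]

/-- The coefficients of the `5`-th power of `t ↦ dF 0 (cuspVec t)` modulo `t ^ 12`. -/
def dFCoeff5 : Fin 12 → ℂ :=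
  ![-1, 10, -30, -10, 160, 142, -1315, 240, 5045, -1360, -17823, 9530]

/-- The coefficients of the `7`-th power of `t ↦ dF 0 (cuspVec t)` modulo `t ^ 12`. -/
def dFCoeff7 : Fin 12 → ℂ :=
  ![-1, 14, -70, 98, 308, -686, -2877, 8724, 9191, -46312, -34461, 226842]

lemma dF_cuspVec : EqMod 12 (fun t => dF 0 (cuspVec t)) (truncPoly dFCoeff1) := by
  refine ⟨fun t => -21 + 4 * t - 4 * t ^ 2 + 34 * t ^ 3 - 4 * t ^ 4 - 24 * t ^ 5 - 6 * t ^ 6 + 32 * t ^ 7 + 24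
    * t ^ 8 + 6 * t ^ 9 - 13 * t ^ 10 - 10 * t ^ 11 - 26 * t ^ 12 - 8 * t ^ 14 - 30 * t ^ 15 -
    12 * t ^ 16 - 12 * t ^ 17 + 28 * t ^ 18 + 26 * t ^ 19 + 28 * t ^ 20 - 2 * t ^ 21 - 19 * t ^
    22 + 23 * t ^ 24 + 12 * t ^ 25 - 5 * t ^ 26 + 14 * t ^ 27 - 2 * t ^ 28 + 16 * t ^ 29 + 10 *
    t ^ 30 - 16 * t ^ 31 - 14 * t ^ 32 - 2 * t ^ 33 - 2 * t ^ 34 - 14 * t ^ 35 - 4 * t ^ 37 - 2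
    * t ^ 38 - 4 * t ^ 39 - 4 * t ^ 40 - 2 * t ^ 41 - 4 * t ^ 44 - t ^ 48, by fun_prop, fun t => ?_⟩
  simp only [dF, GG0, GG1, GG2, GG3, GG4, GG5, GG6, GG7, GG8, GG9, GG10, GG11, GG12,
    DD0, DD1, DD2, DD3, DD4, DD5, DD6, DD7, DD8, DD9, DD10, DD11, DD12, DDinf]
  simp [truncPoly, dFCoeff1, Fin.sum_univ_succ, cuspVec]
  ring

lemma dF_pow_2 : EqMod 12 (fun t => dF 0 (cuspVec t) ^ 2) (truncPoly dFCoeff2) := by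
  refine ((dF_cuspVec.mul dF_cuspVec).trans ⟨fun t =>
    -403 + 48 * t - 22 * t ^ 2 + 236 * t ^ 3 + 51 * t ^ 4 - 252 * t ^ 5 + 794 * t ^ 6 - 748 * t
    ^ 7 + 169 * t ^ 8 - 572 * t ^ 9 + 484 * t ^ 10, by fun_prop, fun t => ?_⟩).congr_left fun t => by ring
  simp [truncPoly, dFCoeff1, dFCoeff2, Fin.sum_univ_succ]
  ring

lemma dF_pow_3 : EqMod 12 (fun t => dF 0 (cuspVec t) ^ 3) (truncPoly dFCoeff3) := by
  refine ((dF_cuspVec.mul dF_pow_2).trans ⟨fun t =>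
    1986 - 76 * t - 2312 * t ^ 2 - 316 * t ^ 3 + 2306 * t ^ 4 - 552 * t ^ 5 - 1704 * t ^ 6 +
    2508 * t ^ 7 + 2630 * t ^ 8 + 116 * t ^ 9 - 3696 * t ^ 10, by fun_prop, fun t => ?_⟩).congr_left fun t => by ring
  simp [truncPoly, dFCoeff1, dFCoeff2, dFCoeff3, Fin.sum_univ_succ]
  ring

lemma dF_pow_5 : EqMod 12 (fun t => dF 0 (cuspVec t) ^ 5) (truncPoly dFCoeff5) := by
  refine ((dF_pow_2.mul dF_pow_3).trans ⟨fun t =>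
    43438 - 30908 * t - 84888 * t ^ 2 + 78724 * t ^ 3 + 115230 * t ^ 4 - 135832 * t ^ 5 - 105112
    * t ^ 6 + 170956 * t ^ 7 + 79170 * t ^ 8 - 194748 * t ^ 9 - 121968 * t ^ 10, by fun_prop, fun t => ?_⟩).congr_left fun t => by ring
  simp [truncPoly, dFCoeff2, dFCoeff3, dFCoeff5, Fin.sum_univ_succ]
  ring

lemma dF_pow_7 : EqMod 12 (fun t => dF 0 (cuspVec t) ^ 7) (truncPoly dFCoeff7) := by
  refine ((dF_pow_2.mul dF_pow_5).trans ⟨fun t =>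
    8282 - 613260 * t - 7624 * t ^ 2 + 1551844 * t ^ 3 - 718086 * t ^ 4 - 1903048 * t ^ 5 +
    1717976 * t ^ 6 + 1650732 * t ^ 7 - 2513762 * t ^ 8 - 2098444 * t ^ 9 + 1601040 * t ^ 10, by fun_prop, fun t => ?_⟩).congr_left fun t => by ring
  simp [truncPoly, dFCoeff2, dFCoeff5, dFCoeff7, Fin.sum_univ_succ]
  ring

lemma Phi20_cuspVec : EqMod 15 (fun t => Phi20 (cuspVec t)) fun t => t ^ 4 := by
  obtain ⟨S, hS, h⟩ := exists_wF_sum (by norm_num) wF_pow_5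
  refine ⟨fun t => 1 / (13 * 25) * S t, by fun_prop, fun t => ?_⟩
  have := h t
  simp only [Fin.sum_univ_succ] at this
  norm_num [wFCoeff5, Fin.succ] at this
  simp only [Phi20, this]
  ring

lemma Phi32_cuspVec : EqMod 15 (fun t => Phi32 (cuspVec t)) fun t => t ^ 9 := by
  obtain ⟨S, hS, h⟩ := exists_wF_sum (by norm_num) wF_pow_8
  refine ⟨fun t => -(1 / (13 * 1840)) * S t, by fun_prop, fun t => ?_⟩
  have := h t
  simp only [Fin.sum_univ_succ] at this
  norm_num [wFCoeff8, Fin.succ] at this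
  simp only [Phi32, this]
  ring

lemma Phi44_cuspVec : EqMod 15 (fun t => Phi44 (cuspVec t)) fun t => t ^ 14 := by
  obtain ⟨S, hS, h⟩ := exists_wF_sum (by norm_num) wF_pow_11
  refine ⟨fun t => 1 / (13 * 146905) * S t, by fun_prop, fun t => ?_⟩
  have := h t
  simp only [Fin.sum_univ_succ] at this
  norm_num [wFCoeff11, Fin.succ] at this
  simp only [Phi44, this]
  ring

lemma Phi12_cuspVec : EqMod 12 (fun t => Phi12 (cuspVec t)) fun t => t ^ 5 := by
  obtain ⟨S, hS, h⟩ := exists_dF_sum (by norm_num) dF_pow_2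
  refine ⟨fun t => -(1 / (13 * 52)) * S t, by fun_prop, fun t => ?_⟩
  have := h t
  simp only [Fin.sum_univ_succ] at this
  norm_num [dFCoeff2, Fin.succ] at this
  simp only [Phi12, this]
  ring

lemma Phi18_cuspVec : EqMod 12 (fun t => Phi18 (cuspVec t)) fun t => t ^ 1 := by
  obtain ⟨S, hS, h⟩ := exists_dF_sum (by norm_num) dF_pow_3
  refine ⟨fun t => 1 / (13 * 6) * S t, by fun_prop, fun t => ?_⟩
  have := h t
  simp only [Fin.sum_univ_succ] at this
  norm_num [dFCoeff3, Fin.succ] at this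
  simp only [Phi18, this]
  ring

lemma Phi30_cuspVec : EqMod 12 (fun t => Phi30 (cuspVec t)) fun t => t ^ 6 := by
  obtain ⟨S, hS, h⟩ := exists_dF_sum (by norm_num) dF_pow_5
  refine ⟨fun t => -(1 / (13 * 1315)) * S t, by fun_prop, fun t => ?_⟩
  have := h t
  simp only [Fin.sum_univ_succ] at this
  norm_num [dFCoeff5, Fin.succ] at this
  simp only [Phi30, this]
  ring

lemma Phi42_cuspVec : EqMod 12 (fun t => Phi42 (cuspVec t)) fun t => t ^ 11 := by
  obtain ⟨S, hS, h⟩ := exists_dF_sum (by norm_num) dF_pow_7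
  refine ⟨fun t => 1 / (13 * 226842) * S t, by fun_prop, fun t => ?_⟩
  have := h t
  simp only [Fin.sum_univ_succ] at this
  norm_num [dFCoeff7, Fin.succ] at this
  simp only [Phi42, this]
  ring

/-! ### Identification of the invariants -/

section Invariants

open UpperHalfPlane hiding I
open ModularForm hiding eta
open ModularFormClass MatrixGroups

lemma eq_eta_pow_mul_of_powSum {Q : (Fin 6 → ℂ) → ℂ} {F : (ZMod 13 → ℂ) → ℂ} {e k n w N m : ℕ}
    {c : ℂ} (hsmul : ∀ (c : ℂ) f, F (c • f) = c ^ (2 * e) * F f)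
    (hT : ∀ a f, F (weilT a f) = F f)
    (hdil : ∀ a f, a ≠ 0 → Function.Odd f → F (dil a f) = F f)
    (hQF : ∀ f, Function.Odd f → Q (toVec f) = c * powSum F e k f)
    (hQ : ContDiff ℂ 1 Q) (hQsmul : ∀ (c : ℂ) v, Q (c • v) = c ^ (2 * e * k) * Q v)
    (hcusp : EqMod m (fun t => Q (cuspVec t)) fun t => t ^ N)
    (hd : 2 * e * k = 4 * n + w) (h3 : 3 ∣ 2 * e * k + n) (hN : N < 15) (hm : N < m)
    (hn : 2 * (2 * e * k) + 3 * N = 13 * n) (hw : w < 12)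
    (M : ModularForm 𝒮ℒ w) (hM : (qExpansion 1 M).coeff 0 = 1) (z : ℍ) :
    Q (xV z) = ModularForm.eta z ^ (8 * n) * M z := by
  obtain ⟨S, hS, hcusp⟩ := hcusp
  have hP (z : ℂ) : Q (xV z) = c * powSum F e k (thVec z) := by
    rw [xV_eq_toVec, hQF _ (thVec_odd z)]
  have hex := exists_levelOne_of_quotient (P := fun z => Q (xV z)) hd h3
    (fun z hz => (hQ.differentiable one_ne_zero).differentiableAt.comp z (xV_differentiableAt hz))
    (fun z => by simp only [hP, powSum_thVec_add_one hsmul hT]; ring)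
    (fun z hz => by simp only [hP, powSum_thVec_neg_inv hsmul hT hdil k hz]; ring)
    (tendsto_comp_xV_div_eta_pow hQsmul hn (tendsto_comp_thVecNormalized hQ hN hm hS hcusp))
  obtain ⟨M', hM', h⟩ := hex
  rw [h, levelOne_eq_of_coeff_zero_eq (by exact_mod_cast hw) (hM'.trans hM.symm)]

lemma contDiff_wF (ν : ℕ) : ContDiff ℂ 1 (wF ν) := by
  unfold wF AA0 AA1 AA2 AA3 AA4 AA5 AA6
  fun_prop

lemma contDiff_wInf : ContDiff ℂ 1 wInf := by
  unfold wInf AA0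
  fun_prop

lemma contDiff_dF (ν : ℕ) : ContDiff ℂ 1 (dF ν) := by
  unfold dF GG0 GG1 GG2 GG3 GG4 GG5 GG6 GG7 GG8 GG9 GG10 GG11 GG12
    DD0 DD1 DD2 DD3 DD4 DD5 DD6 DD7 DD8 DD9 DD10 DD11 DD12 DDinf
  fun_prop

lemma contDiff_dInf : ContDiff ℂ 1 dInf := by
  unfold dInf GG0 DD0 DDinf
  fun_prop

lemma eq_eta_pow_mul_of_quartic {Q : (Fin 6 → ℂ) → ℂ} {k n w N : ℕ} {c : ℂ}
    (hQ : ∀ v, Q v = c * (∑ ν ∈ Finset.range 13, wF ν v ^ k + wInf v ^ k))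
    (hcusp : EqMod 15 (fun t => Q (cuspVec t)) fun t => t ^ N)
    (hd : 4 * k = 4 * n + w) (h3 : 3 ∣ 4 * k + n) (hN : N < 15)
    (hn : 2 * (4 * k) + 3 * N = 13 * n) (hw : w < 12)
    (M : ModularForm 𝒮ℒ w) (hM : (qExpansion 1 M).coeff 0 = 1) (z : ℍ) :
    Q (xV z) = ModularForm.eta z ^ (8 * n) * M z := by
  refine eq_eta_pow_mul_of_powSum (e := 2) (k := k) (c := c) quarticF_smul quarticF_weilT
    quarticF_dil (fun f hf => by rw [hQ, powSum_quarticF hf]) ?_ (fun b v => ?_) hcusp hd h3 hN hN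
    hn hw M hM z
  · rw [show Q = _ from funext hQ]
    have h1 := contDiff_wF
    have h2 := contDiff_wInf
    fun_prop
  · simp only [hQ, wF_smul, wInf_smul, mul_pow, ← Finset.mul_sum, ← pow_mul]
    ring

lemma eq_eta_pow_mul_of_sextic {Q : (Fin 6 → ℂ) → ℂ} {k n w N : ℕ} {c : ℂ}
    (hQ : ∀ v, Q v = c * (∑ ν ∈ Finset.range 13, dF ν v ^ k + dInf v ^ k))
    (hcusp : EqMod 12 (fun t => Q (cuspVec t)) fun t => t ^ N)
    (hd : 6 * k = 4 * n + w) (h3 : 3 ∣ 6 * k + n) (hN : N < 12)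
    (hn : 2 * (6 * k) + 3 * N = 13 * n) (hw : w < 12)
    (M : ModularForm 𝒮ℒ w) (hM : (qExpansion 1 M).coeff 0 = 1) (z : ℍ) :
    Q (xV z) = ModularForm.eta z ^ (8 * n) * M z := by
  refine eq_eta_pow_mul_of_powSum (e := 3) (k := k) (c := c) sexticF_smul sexticF_weilT
    sexticF_dil (fun f hf => by rw [hQ, powSum_sexticF hf]) ?_ (fun b v => ?_) hcusp hd h3
    (by omega) hN hn hw M hM z
  · rw [show Q = _ from funext hQ]
    have h1 := contDiff_dF
    have h2 := contDiff_dInf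
    fun_prop
  · simp only [hQ, dF_smul, dInf_smul, mul_pow, ← Finset.mul_sum, ← pow_mul]
    ring

lemma E₄_coeff_zero : (qExpansion 1 E₄).coeff 0 = 1 :=
  EisensteinSeries.E_qExpansion_coeff_zero _ ⟨2, rfl⟩

lemma E₆_coeff_zero : (qExpansion 1 E₆).coeff 0 = 1 :=
  EisensteinSeries.E_qExpansion_coeff_zero _ ⟨3, rfl⟩

lemma Phi12_xV (z : ℍ) : Phi12 (xV z) = ModularForm.eta z ^ 24 := by
  rw [← mul_one (_ ^ 24)]
  refine eq_eta_pow_mul_of_sextic (w := 0) (n := 3) (fun _ => rfl) Phi12_cuspVec rfl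
    (by norm_num) (by norm_num) rfl (by norm_num) (1 : ModularForm 𝒮ℒ 0) ?_ z
  erw [ModularForm.qExpansion_one]
  simp

lemma Phi18_xV (z : ℍ) : Phi18 (xV z) = ModularForm.eta z ^ 24 * E₆ z :=
  eq_eta_pow_mul_of_sextic (w := 6) (n := 3) (fun _ => rfl) Phi18_cuspVec rfl
    (by norm_num) (by norm_num) rfl (by norm_num) E₆ E₆_coeff_zero z

lemma Phi30_xV (z : ℍ) : Phi30 (xV z) = ModularForm.eta z ^ 48 * E₆ z :=
  eq_eta_pow_mul_of_sextic (w := 6) (n := 6) (fun _ => rfl) Phi30_cuspVec rfl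
    (by norm_num) (by norm_num) rfl (by norm_num) E₆ E₆_coeff_zero z

lemma Phi42_xV (z : ℍ) : Phi42 (xV z) = ModularForm.eta z ^ 72 * E₆ z :=
  eq_eta_pow_mul_of_sextic (w := 6) (n := 9) (fun _ => rfl) Phi42_cuspVec rfl
    (by norm_num) (by norm_num) rfl (by norm_num) E₆ E₆_coeff_zero z

lemma Phi20_xV (z : ℍ) : Phi20 (xV z) = ModularForm.eta z ^ 32 * E₄ z :=
  eq_eta_pow_mul_of_quartic (w := 4) (n := 4) (fun _ => rfl) Phi20_cuspVec rfl
    (by norm_num) (by norm_num) rfl (by norm_num) E₄ E₄_coeff_zero z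

lemma Phi32_xV (z : ℍ) : Phi32 (xV z) = ModularForm.eta z ^ 56 * E₄ z :=
  eq_eta_pow_mul_of_quartic (w := 4) (n := 7) (fun _ => rfl) Phi32_cuspVec rfl
    (by norm_num) (by norm_num) rfl (by norm_num) E₄ E₄_coeff_zero z

lemma Phi44_xV (z : ℍ) : Phi44 (xV z) = ModularForm.eta z ^ 80 * E₄ z :=
  eq_eta_pow_mul_of_quartic (w := 4) (n := 10) (fun _ => rfl) Phi44_cuspVec rfl
    (by norm_num) (by norm_num) rfl (by norm_num) E₄ E₄_coeff_zero z

lemma eta_pow_eq_E₄_E₆ (z : ℍ) : E₄ z ^ 3 - E₆ z ^ 2 = 1728 * ModularForm.eta z ^ 24 := by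
  have h := discriminant_eq_E₄_cube_sub_E₆_sq z
  rw [discriminant] at h
  rw [h]
  ring

end Invariants

theorem stmt16 (z : ℂ) (hz : 0 < z.im) :
    (Phi20 (xV z)) ^ 3 * (Phi12 (xV z)) ^ 2 - (Phi42 (xV z)) ^ 2 = 1728 * (Phi12 (xV z)) ^ 7 ∧
    (Phi32 (xV z)) ^ 3 - (Phi12 (xV z)) ^ 5 * (Phi18 (xV z)) ^ 2 = 1728 * (Phi12 (xV z)) ^ 8 ∧
    (Phi32 (xV z)) ^ 3 - (Phi12 (xV z)) ^ 3 * (Phi30 (xV z)) ^ 2 = 1728 * (Phi12 (xV z)) ^ 8 ∧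
    (Phi32 (xV z)) ^ 3 - (Phi12 (xV z)) * (Phi42 (xV z)) ^ 2 = 1728 * (Phi12 (xV z)) ^ 8 ∧
    (Phi44 (xV z)) ^ 3 - (Phi12 (xV z)) ^ 8 * (Phi18 (xV z)) ^ 2 = 1728 * (Phi12 (xV z)) ^ 11 ∧
    (Phi44 (xV z)) ^ 3 - (Phi12 (xV z)) ^ 6 * (Phi30 (xV z)) ^ 2 = 1728 * (Phi12 (xV z)) ^ 11 ∧
    (Phi44 (xV z)) ^ 3 - (Phi12 (xV z)) ^ 4 * (Phi42 (xV z)) ^ 2 = 1728 * (Phi12 (xV z)) ^ 11 := by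
  lift z to UpperHalfPlane using hz
  have h := eta_pow_eq_E₄_E₆ z
  simp only [Phi12_xV, Phi18_xV, Phi30_xV, Phi42_xV, Phi20_xV, Phi32_xV, Phi44_xV]
  refine ⟨?_, ?_, ?_, ?_, ?_, ?_, ?_⟩
  · linear_combination ModularForm.eta z ^ 144 * h
  · linear_combination ModularForm.eta z ^ 168 * h
  · linear_combination ModularForm.eta z ^ 168 * h
  · linear_combination ModularForm.eta z ^ 168 * h
  · linear_combination ModularForm.eta z ^ 240 * h
  · linear_combination ModularForm.eta z ^ 240 * h
  · linear_combination ModularForm.eta z ^ 240 * h
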